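/- arXiv:1712.09457 — 2 statements merged into one kernel-verified Lean document; each statement's English description precedes it below -/
import Mathlib

section
/- Fix real numbers θ and ε with θ > ε > 0. There exists a constant C = C(θ,ε) > 0 with the following property. Let n be a positive integer and let ψ : ℝ² → ℝ be a smooth ℤ²-periodic function, not identically zero, with Δψ = −4π²n·ψ on ℝ². Assume ψ has no singular point, i.e., ψ(p) = 0 implies ∇ψ(p) ≠ 0 for all p ∈ ℝ². Assume further there exists α ∈ ℝ such that no (a,b) ∈ ℤ² with a² + b² = n lies in the open sector S_{α,2θ} = {(r cos φ, r sin φ) : r > 0, α < φ < α + 2θ}. Let φ be the induced function on the flat torus 𝕋 = ℝ²/ℤ² and let N(φ) be the number of connected components of {x ∈ 𝕋 : φ(x) ≠ 0}. Then N(φ) ≤ (4π²n/(2π²))·cos(θ − ε) + C·√n = 2n·cos(θ − ε) + C·√n. -/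
open Real

/-- The Euclidean Laplacian of a function `ψ : ℝ × ℝ → ℝ`. -/
noncomputable def laplacian2 (ψ : ℝ × ℝ → ℝ) (p : ℝ × ℝ) : ℝ :=
  deriv (fun x => deriv (fun x' => ψ (x', p.2)) x) p.1 +
  deriv (fun y => deriv (fun y' => ψ (p.1, y')) y) p.2

/-- The open sector `S_{α,β} = {(r cos φ, r sin φ) : r > 0, α < φ < α + β}`. -/
def openSector (α β : ℝ) : Set (ℝ × ℝ) :=
  {x : ℝ × ℝ | ∃ r φ : ℝ, 0 < r ∧ α < φ ∧ φ < α + β ∧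
    x = (r * Real.cos φ, r * Real.sin φ)}

/-- The flat torus `ℝ²/ℤ²`. -/
abbrev Torus2 := AddCircle (1 : ℝ) × AddCircle (1 : ℝ)

section Flow

open Set Filter Topology NNReal

variable {E : Type*} [NormedAddCommGroup E] [NormedSpace ℝ E]

theorem exists_global_integralCurve [CompleteSpace E] {X : E → E} {K L : ℝ≥0}
    (hK : LipschitzWith K X) (hL : ∀ x, ‖X x‖ ≤ L) (x : E) :
    ∃ γ : ℝ → E, γ 0 = x ∧ ∀ t, HasDerivAt γ (X (γ t)) t := by
  have local_curve : ∀ T : ℝ, 0 < T → ∃ γ : ℝ → E, γ 0 = x ∧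
      ∀ t ∈ Ioo (-T) T, HasDerivAt γ (X (γ t)) t := by
    intro T hT
    have h0 : (0 : ℝ) ∈ Icc (-T) T := ⟨by linarith, hT.le⟩
    have hPL : IsPicardLindelof (fun _ ↦ X) (⟨0, h0⟩ : Icc (-T) T) x (L * T.toNNReal) 0 L K := by
      apply IsPicardLindelof.of_time_independent (fun y _ ↦ hL y) hK.lipschitzOnWith
      simp [Real.coe_toNNReal T hT.le]
    obtain ⟨γ, h1, h2⟩ := hPL.exists_eq_forall_mem_Icc_hasDerivWithinAt₀
    exact ⟨γ, h1, fun t ht ↦ (h2 t (Ioo_subset_Icc_self ht)).hasDerivAt (Icc_mem_nhds ht.1 ht.2)⟩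
  choose! γ hγ0 hγ using local_curve
  have agree : ∀ S T : ℝ, 0 < S → S ≤ T → EqOn (γ S) (γ T) (Ioo (-S) S) := by
    intro S T hS hST
    refine ODE_solution_unique_of_mem_Ioo (v := fun _ ↦ X) (s := fun _ ↦ univ) (K := K)
      (t₀ := 0) (fun _ _ ↦ hK.lipschitzOnWith) ⟨by linarith, hS⟩
      (fun t ht ↦ ⟨hγ S hS t ht, trivial⟩)
      (fun t ht ↦ ⟨hγ T (hS.trans_le hST) t ⟨by linarith [ht.1], by linarith [ht.2]⟩, trivial⟩)
      (by rw [hγ0 S hS, hγ0 T (hS.trans_le hST)])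
  refine ⟨fun t ↦ γ (|t| + 1) t, by simp [hγ0], fun t ↦ ?_⟩
  have hpos : (0 : ℝ) < |t| + 2 := by positivity
  have hmem : t ∈ Ioo (-(|t| + 1)) (|t| + 1) :=
    ⟨by linarith [neg_abs_le t], by linarith [le_abs_self t]⟩
  have hval : γ (|t| + 1) t = γ (|t| + 2) t :=
    agree _ _ (by positivity) (by linarith) hmem
  have hev : (fun s ↦ γ (|s| + 1) s) =ᶠ[𝓝 t] γ (|t| + 2) := by
    filter_upwards [(continuous_abs.continuousAt (x := t)).eventually
      (gt_mem_nhds (show |t| < |t| + 1 by linarith))] with s hs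
    exact agree _ _ (by positivity) (by linarith)
      ⟨by linarith [neg_abs_le s], by linarith [le_abs_self s]⟩
  have hd := hγ (|t| + 2) hpos t ⟨by linarith [neg_abs_le t], by linarith [le_abs_self t]⟩
  beta_reduce
  rw [hval]
  exact hd.congr_of_eventuallyEq hev

theorem integralCurve_comp_add {X : E → E} {γ : ℝ → E} (hγ : ∀ t, HasDerivAt γ (X (γ t)) t)
    (s : ℝ) : ∀ t, HasDerivAt (fun t ↦ γ (t + s)) (X (γ (t + s))) t :=
  fun t ↦ (hγ (t + s)).comp_add_const t s

theorem integralCurve_unique {X : E → E} {K : ℝ≥0} (hK : LipschitzWith K X) {γ η : ℝ → E}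
    (hγ : ∀ t, HasDerivAt γ (X (γ t)) t) (hη : ∀ t, HasDerivAt η (X (η t)) t) {s t : ℝ}
    (h : γ s = η t) (u : ℝ) : γ (u + s) = η (u + t) := by
  have := ODE_solution_unique_univ (v := fun _ ↦ X) (s := fun _ ↦ univ) (K := K)
    (t₀ := 0) (fun _ ↦ hK.lipschitzOnWith)
    (fun t ↦ ⟨integralCurve_comp_add hγ s t, trivial⟩)
    (fun u ↦ ⟨integralCurve_comp_add hη t u, trivial⟩) (by simpa using h)
  exact congrFun this u

/-- A set that is carried into itself by all forward trajectories has a closure with the same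
property. -/
theorem integralCurve_mem_closure [CompleteSpace E] {X : E → E} {K L : ℝ≥0}
    (hK : LipschitzWith K X) (hL : ∀ x, ‖X x‖ ≤ L) {S : Set E}
    (hS : ∀ γ : ℝ → E, (∀ t, HasDerivAt γ (X (γ t)) t) → γ 0 ∈ S → ∀ t, γ t ∈ S)
    {γ : ℝ → E} (hγ : ∀ t, HasDerivAt γ (X (γ t)) t) (h0 : γ 0 ∈ closure S) {t : ℝ}
    (ht : 0 ≤ t) : γ t ∈ closure S := by
  rw [Metric.mem_closure_iff] at h0 ⊢
  intro ε hε
  obtain ⟨y, hy, hxy⟩ := h0 (ε / exp (K * t)) (by positivity)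
  obtain ⟨η, hη0, hη⟩ := exists_global_integralCurve hK hL y
  refine ⟨η t, hS η hη (hη0 ▸ hy) t, ?_⟩
  have := dist_le_of_trajectories_ODE (v := fun _ ↦ X) (a := 0) (b := t) (f := γ) (g := η)
    (fun _ ↦ hK)
    (fun s _ ↦ (hγ s).continuousAt.continuousWithinAt) (fun s _ ↦ (hγ s).hasDerivWithinAt)
    (fun s _ ↦ (hη s).continuousAt.continuousWithinAt) (fun s _ ↦ (hη s).hasDerivWithinAt)
    (le_refl (dist (γ 0) (η 0))) t ⟨ht, le_rfl⟩
  rw [sub_zero, hη0] at this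
  refine this.trans_lt ?_
  rwa [lt_div_iff₀ (exp_pos _)] at hxy

/-- If `f` and `f'` vanish and are positive at both ends, `f` has an interior zero with
nonpositive derivative. -/
theorem exists_zero_deriv_nonpos {f f' : ℝ → ℝ} (hf : ∀ t, HasDerivAt f (f' t) t) {T : ℝ}
    (hT : 0 < T) (h0 : f 0 = 0) (h0' : 0 < f' 0) (hfT : f T = 0) (hfT' : 0 < f' T) :
    ∃ t, 0 < t ∧ t < T ∧ f t = 0 ∧ f' t ≤ 0 := by
  have hcont : Continuous f := continuous_iff_continuousAt.2 fun t ↦ (hf t).continuousAt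
  have right : ∀ᶠ t in 𝓝[>] (0 : ℝ), 0 < f t := by
    have h := (hasDerivWithinAt_iff_tendsto_slope' (by simp)).1
      ((hf 0).hasDerivWithinAt (s := Ioi 0))
    filter_upwards [h.eventually (lt_mem_nhds h0'), self_mem_nhdsWithin] with t ht ht0
    have ht0' : (0 : ℝ) < t := ht0
    rw [slope_def_field, h0, sub_zero, sub_zero] at ht
    exact (div_pos_iff_of_pos_right ht0').1 ht
  have left : ∀ᶠ t in 𝓝[<] T, f t < 0 := by
    have h := (hasDerivWithinAt_iff_tendsto_slope' (by simp)).1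
      ((hf T).hasDerivWithinAt (s := Iio T))
    filter_upwards [h.eventually (lt_mem_nhds hfT'), self_mem_nhdsWithin] with t ht ht0
    have ht0' : t - T < 0 := sub_neg.2 ht0
    rw [slope_def_field, hfT, sub_zero] at ht
    by_contra! hc
    exact absurd ht (not_lt.2 (div_nonpos_of_nonneg_of_nonpos hc ht0'.le))
  obtain ⟨u, hu0, hu⟩ := (mem_nhdsGT_iff_exists_Ioo_subset).1 right
  obtain ⟨w, hwT, hw⟩ := (mem_nhdsLT_iff_exists_Ioo_subset).1 left
  have hu0 : 0 < u := hu0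
  have hwT : w < T := hwT
  obtain ⟨c, hc, hcT⟩ : ∃ c, max w 0 < c ∧ c < T := exists_between (max_lt hwT hT)
  have hfc : f c < 0 := hw ⟨(le_max_left _ _).trans_lt hc, hcT⟩
  have hc0 : 0 < c := (le_max_right _ _).trans_lt hc
  set d := min u c / 2 with hd
  have hmin : 0 < min u c := lt_min hu0 hc0
  have hd0 : 0 < d := by positivity
  have hdu : d < u := by linarith [min_le_left u c]
  have hdc : d < c := by linarith [min_le_right u c]
  set A := {t | t ∈ Icc d c ∧ f t ≤ 0} with hA
  have hAne : A.Nonempty := ⟨c, ⟨hdc.le, le_rfl⟩, hfc.le⟩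
  have hAclosed : IsClosed A := isClosed_Icc.inter (isClosed_le hcont continuous_const)
  have hAbdd : BddBelow A := ⟨d, fun t ht ↦ ht.1.1⟩
  have hmem : sInf A ∈ A := hAclosed.csInf_mem hAne hAbdd
  set a := sInf A
  have hfd : 0 < f d := hu ⟨hd0, hdu⟩
  have hda : d < a := lt_of_le_of_ne hmem.1.1 (fun h ↦ by
    have := hmem.2; rw [← h] at this; linarith)
  have hbefore : ∀ t, d < t → t < a → 0 < f t := by
    intro t h1 h2
    by_contra! hc'
    exact absurd (csInf_le hAbdd (show t ∈ A from ⟨⟨h1.le, h2.le.trans hmem.1.2⟩, hc'⟩))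
      (not_le.2 h2)
  have hevent : ∀ᶠ t in 𝓝[<] a, 0 < f t := by
    filter_upwards [Ioo_mem_nhdsLT hda] with t ht using hbefore t ht.1 ht.2
  have hfa : f a = 0 := by
    refine le_antisymm hmem.2 ?_
    exact ge_of_tendsto (hcont.continuousAt.continuousWithinAt (s := Iio a))
      (hevent.mono fun _ h ↦ h.le)
  refine ⟨a, hd0.trans hda, hmem.1.2.trans_lt hcT, hfa, ?_⟩
  have h := (hasDerivWithinAt_iff_tendsto_slope' (by simp)).1 ((hf a).hasDerivWithinAt (s := Iio a))
  refine le_of_tendsto h ?_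
  filter_upwards [hevent, self_mem_nhdsWithin] with t ht ht0
  have ht0' : t - a < 0 := sub_neg.2 ht0
  rw [slope_def_field, hfa, sub_zero]
  exact div_nonpos_of_nonneg_of_nonpos ht.le ht0'.le

end Flow

section NodalDomain

open Set Filter Topology NNReal

/-- `Ω` is a connected component of `{f ≠ 0}`. -/
def IsNodalDomain (f : ℝ × ℝ → ℝ) (Ω : Set (ℝ × ℝ)) : Prop :=
  ∃ x, f x ≠ 0 ∧ Ω = connectedComponentIn {p | f p ≠ 0} x

namespace IsNodalDomain

variable {f : ℝ × ℝ → ℝ} {Ω Ω' : Set (ℝ × ℝ)}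

theorem ne_zero (h : IsNodalDomain f Ω) {x : ℝ × ℝ} (hx : x ∈ Ω) : f x ≠ 0 := by
  obtain ⟨y, -, rfl⟩ := h
  exact connectedComponentIn_subset _ _ hx

theorem nonempty (h : IsNodalDomain f Ω) : Ω.Nonempty := by
  obtain ⟨y, hy, rfl⟩ := h
  exact ⟨y, mem_connectedComponentIn hy⟩

theorem isPreconnected (h : IsNodalDomain f Ω) : IsPreconnected Ω := by
  obtain ⟨y, -, rfl⟩ := h
  exact isPreconnected_connectedComponentIn

theorem isOpen (h : IsNodalDomain f Ω) (hf : Continuous f) : IsOpen Ω := by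
  obtain ⟨y, -, rfl⟩ := h
  exact (isOpen_ne_fun hf continuous_const).connectedComponentIn

theorem eq_connectedComponentIn (h : IsNodalDomain f Ω) {x : ℝ × ℝ} (hx : x ∈ Ω) :
    Ω = connectedComponentIn {p | f p ≠ 0} x := by
  obtain ⟨y, -, rfl⟩ := h
  exact connectedComponentIn_eq hx

theorem eq_of_mem (h : IsNodalDomain f Ω) (h' : IsNodalDomain f Ω') {x : ℝ × ℝ} (hx : x ∈ Ω)
    (hx' : x ∈ Ω') : Ω = Ω' := by
  rw [h.eq_connectedComponentIn hx, ← h'.eq_connectedComponentIn hx']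

theorem subset_of_isPreconnected (h : IsNodalDomain f Ω) {S : Set (ℝ × ℝ)}
    (hS : IsPreconnected S) (hne : ∀ x ∈ S, f x ≠ 0) {x : ℝ × ℝ} (hx : x ∈ Ω) (hxS : x ∈ S) :
    S ⊆ Ω := by
  rw [h.eq_connectedComponentIn hx]
  exact hS.subset_connectedComponentIn hxS hne

theorem mem_of_mem_closure (h : IsNodalDomain f Ω) {x : ℝ × ℝ} (hx : x ∈ closure Ω)
    (hfx : f x ≠ 0) : x ∈ Ω := by
  obtain ⟨y, hy⟩ := h.nonempty
  have : IsPreconnected (insert x Ω) :=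
    h.isPreconnected.subset_closure (subset_insert _ _)
      (insert_subset hx subset_closure)
  refine h.subset_of_isPreconnected this ?_ hy (mem_insert_of_mem _ hy) (mem_insert _ _)
  rintro z (rfl | hz)
  exacts [hfx, h.ne_zero hz]

theorem mul_pos (h : IsNodalDomain f Ω) (hf : Continuous f) {x y : ℝ × ℝ} (hx : x ∈ Ω)
    (hy : y ∈ Ω) : 0 < f x * f y := by
  by_contra! hneg
  obtain ⟨z, hz, hz0⟩ : (0 : ℝ) ∈ f '' Ω := by
    rcases mul_nonpos_iff.1 hneg with ⟨h1, h2⟩ | ⟨h1, h2⟩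
    · exact h.isPreconnected.intermediate_value hy hx hf.continuousOn ⟨h2, h1⟩
    · exact h.isPreconnected.intermediate_value hx hy hf.continuousOn ⟨h1, h2⟩
  exact h.ne_zero hz hz0

theorem translate (h : IsNodalDomain f Ω) {u : ℝ × ℝ} (hu : ∀ x, f (x + u) = f x) :
    IsNodalDomain f ((fun x ↦ x + u) '' Ω) := by
  obtain ⟨y, hy, rfl⟩ := h
  refine ⟨y + u, by simpa [hu] using hy, ?_⟩
  have := (Homeomorph.addRight u).image_connectedComponentIn (s := {p | f p ≠ 0}) (x := y) hy
  simp only [Homeomorph.coe_addRight] at this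
  rw [this]
  congr 1
  ext z
  simp only [mem_image, mem_ofPred_eq]
  constructor
  · rintro ⟨w, hw, rfl⟩
    rwa [hu]
  · intro hz
    exact ⟨z - u, by rwa [← hu (z - u), sub_add_cancel], sub_add_cancel _ _⟩

end IsNodalDomain

/-- The Hamiltonian vector field `(∂f/∂y, -∂f/∂x)`. -/
noncomputable def hamiltonianField (f : ℝ × ℝ → ℝ) (p : ℝ × ℝ) : ℝ × ℝ :=
  (fderiv ℝ f p (0, 1), -fderiv ℝ f p (1, 0))

theorem map_eq_fst_snd (A : ℝ × ℝ →L[ℝ] ℝ) (x : ℝ × ℝ) :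
    A x = x.1 * A (1, 0) + x.2 * A (0, 1) := by
  have : x = x.1 • ((1 : ℝ), (0 : ℝ)) + x.2 • ((0 : ℝ), (1 : ℝ)) := by ext <;> simp
  conv_lhs => rw [this]
  simp only [map_add, map_smul, smul_eq_mul]

variable {f : ℝ × ℝ → ℝ} {p : ℝ × ℝ}

theorem fderiv_hamiltonianField : fderiv ℝ f p (hamiltonianField f p) = 0 := by
  rw [map_eq_fst_snd]
  simp only [hamiltonianField]
  ring

theorem exists_straightening (hf : ContDiff ℝ 1 f) (hp : fderiv ℝ f p ≠ 0) :
    ∃ (l : ℝ × ℝ →L[ℝ] ℝ) (e : OpenPartialHomeomorph (ℝ × ℝ) (ℝ × ℝ)), p ∈ e.source ∧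
      (∀ x, e x = (f x, l x)) ∧ 0 < l (hamiltonianField f p) := by
  set X := hamiltonianField f p with hX
  set l : ℝ × ℝ →L[ℝ] ℝ :=
    X.1 • ContinuousLinearMap.fst ℝ ℝ ℝ + X.2 • ContinuousLinearMap.snd ℝ ℝ ℝ with hl
  have hlx : ∀ x, l x = X.1 * x.1 + X.2 * x.2 := fun x ↦ by simp [hl]
  have hXne : 0 < X.1 * X.1 + X.2 * X.2 := by
    rcases eq_or_ne X.1 0 with h1 | h1
    · rcases eq_or_ne X.2 0 with h2 | h2
      · exfalso
        apply hp
        ext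
        · simp only [hX, hamiltonianField, neg_eq_zero] at h2
          simpa using h2
        · simp only [hX, hamiltonianField] at h1
          simpa using h1
      · have := mul_self_pos.2 h2
        positivity
    · exact add_pos_of_pos_of_nonneg (mul_self_pos.2 h1) (mul_self_nonneg _)
  set A : ℝ × ℝ →L[ℝ] ℝ × ℝ := (fderiv ℝ f p).prod l with hA
  have hinj : Function.Injective A := by
    rw [injective_iff_map_eq_zero]
    intro x hx
    have h1 : fderiv ℝ f p x = 0 := congrArg Prod.fst hx
    have h2 : l x = 0 := congrArg Prod.snd hx
    rw [map_eq_fst_snd] at h1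
    rw [hlx] at h2
    have e1 : fderiv ℝ f p (0, 1) = X.1 := rfl
    have e2 : fderiv ℝ f p (1, 0) = -X.2 := by simp [hX, hamiltonianField]
    rw [e1, e2] at h1
    ext
    · have : (X.1 * X.1 + X.2 * X.2) * x.1 = 0 := by linear_combination X.1 * h2 - X.2 * h1
      exact (mul_eq_zero.1 this).resolve_left hXne.ne'
    · have : (X.1 * X.1 + X.2 * X.2) * x.2 = 0 := by linear_combination X.2 * h2 + X.1 * h1
      exact (mul_eq_zero.1 this).resolve_left hXne.ne'
  let A' : (ℝ × ℝ) ≃L[ℝ] ℝ × ℝ :=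
    (LinearEquiv.ofInjectiveEndo A.toLinearMap hinj).toContinuousLinearEquiv
  have hA' : (A' : ℝ × ℝ →L[ℝ] ℝ × ℝ) = A := by
    ext <;> rfl
  have hd : HasStrictFDerivAt (fun x ↦ (f x, l x)) (A' : ℝ × ℝ →L[ℝ] ℝ × ℝ) p := by
    rw [hA']
    exact (hf.contDiffAt.hasStrictFDerivAt one_ne_zero).prodMk l.hasStrictFDerivAt
  refine ⟨l, hd.toOpenPartialHomeomorph _, hd.mem_toOpenPartialHomeomorph_source,
    fun x ↦ rfl, ?_⟩
  rw [hlx]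
  exact hXne

/-- Near a regular zero, points where `f` has the same sign lie in the same nodal domain. -/
theorem exists_nhds_forall_mem_connectedComponentIn (hf : ContDiff ℝ 1 f)
    (hp : fderiv ℝ f p ≠ 0) :
    ∃ U ∈ 𝓝 p, ∀ x ∈ U, ∀ y ∈ U, 0 < f x * f y →
      y ∈ connectedComponentIn {z | f z ≠ 0} x := by
  obtain ⟨l, e, hpe, he, -⟩ := exists_straightening hf hp
  obtain ⟨r, hr, hball⟩ := Metric.mem_nhds_iff.1 (e.open_target.mem_nhds (e.map_source hpe))
  refine ⟨e.source ∩ e ⁻¹' Metric.ball (e p) r,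
    (e.continuousAt hpe).preimage_mem_nhds (Metric.ball_mem_nhds _ hr) |>
      inter_mem (e.open_source.mem_nhds hpe), ?_⟩
  rintro x ⟨hxs, hxb⟩ y ⟨hys, hyb⟩ hxy
  have hfe : ∀ z ∈ e.target, f (e.symm z) = z.1 := fun z hz ↦ by
    conv_rhs => rw [← e.right_inv hz, he]
  have key : ∀ S : Set (ℝ × ℝ), Convex ℝ S → (∀ z ∈ S, z.1 ≠ 0) → e x ∈ S → e y ∈ S →
      y ∈ connectedComponentIn {z | f z ≠ 0} x := by
    intro S hS hne hx hy
    have hT : IsPreconnected (e.symm '' (Metric.ball (e p) r ∩ S)) :=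
      ((convex_ball _ _).inter hS).isPreconnected.image _
        (e.continuousOn_symm.mono (inter_subset_left.trans hball))
    refine hT.subset_connectedComponentIn ⟨e x, ⟨hxb, hx⟩, e.left_inv hxs⟩ ?_
      ⟨e y, ⟨hyb, hy⟩, e.left_inv hys⟩
    rintro _ ⟨z, hz, rfl⟩
    simp only [mem_ofPred_eq]
    rw [hfe z (hball hz.1)]
    exact hne z hz.2
  rcases mul_pos_iff.1 hxy with ⟨h1, h2⟩ | ⟨h1, h2⟩
  · exact key {z | 0 < z.1} (convex_halfSpace_gt (IsLinearMap.mk (fun _ _ ↦ rfl) (fun _ _ ↦ rfl)) 0)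
      (fun z hz ↦ hz.ne') (by simpa [he] using h1) (by simpa [he] using h2)
  · exact key {z | z.1 < 0} (convex_halfSpace_lt (IsLinearMap.mk (fun _ _ ↦ rfl) (fun _ _ ↦ rfl)) 0)
      (fun z hz ↦ hz.ne) (by simpa [he] using h1) (by simpa [he] using h2)

/-- Two nodal domains of the same sign with a common regular boundary point coincide. -/
theorem IsNodalDomain.eq_of_mem_closure {Ω Ω' : Set (ℝ × ℝ)} (hf : ContDiff ℝ 1 f)
    (h : IsNodalDomain f Ω) (h' : IsNodalDomain f Ω') (hp : fderiv ℝ f p ≠ 0)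
    (hpΩ : p ∈ closure Ω) (hpΩ' : p ∈ closure Ω') {x y : ℝ × ℝ} (hx : x ∈ Ω) (hy : y ∈ Ω')
    (hxy : 0 < f x * f y) : Ω = Ω' := by
  obtain ⟨U, hU, hUc⟩ := exists_nhds_forall_mem_connectedComponentIn hf hp
  obtain ⟨a, haU, ha⟩ := mem_closure_iff_nhds.1 hpΩ U hU
  obtain ⟨b, hbU, hb⟩ := mem_closure_iff_nhds.1 hpΩ' U hU
  have h1 := h.mul_pos hf.continuous ha hx
  have h2 := h'.mul_pos hf.continuous hy hb
  have hab : 0 < f a * f b := by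
    have h3 : 0 < (f a * f b) * (f x * f y) := by
      have := _root_.mul_pos h1 h2
      linarith
    exact (pos_iff_pos_of_mul_pos h3).2 hxy
  have := hUc a haU b hbU hab
  rw [← h.eq_connectedComponentIn ha] at this
  exact h.eq_of_mem h' this hb

section Trajectories

variable {K L : ℝ≥0}

theorem hasDerivAt_comp_integralCurve_hamiltonianField (hf : ContDiff ℝ 1 f) {γ : ℝ → ℝ × ℝ}
    (hγ : ∀ t, HasDerivAt γ (hamiltonianField f (γ t)) t) (t : ℝ) :
    HasDerivAt (fun t ↦ f (γ t)) 0 t := by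
  have := ((hf.differentiable one_ne_zero (γ t)).hasFDerivAt.comp_hasDerivAt t (hγ t))
  rwa [fderiv_hamiltonianField] at this

theorem apply_integralCurve_hamiltonianField (hf : ContDiff ℝ 1 f) {γ : ℝ → ℝ × ℝ}
    (hγ : ∀ t, HasDerivAt γ (hamiltonianField f (γ t)) t) (s t : ℝ) : f (γ s) = f (γ t) :=
  is_const_of_deriv_eq_zero
    (fun t ↦ (hasDerivAt_comp_integralCurve_hamiltonianField hf hγ t).differentiableAt)
    (fun t ↦ (hasDerivAt_comp_integralCurve_hamiltonianField hf hγ t).deriv) s t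

theorem continuous_hamiltonianField (hf : ContDiff ℝ 1 f) : Continuous (hamiltonianField f) := by
  have := hf.continuous_fderiv one_ne_zero
  unfold hamiltonianField
  fun_prop

/-- The zeros of `f` near a regular zero lie on the trajectory through it. -/
theorem eventually_exists_integralCurve_eq (hf : ContDiff ℝ 1 f) {γ : ℝ → ℝ × ℝ}
    (hγ : ∀ t, HasDerivAt γ (hamiltonianField f (γ t)) t) (h0 : f (γ 0) = 0)
    (hreg : fderiv ℝ f (γ 0) ≠ 0) {δ : ℝ} (hδ : 0 < δ) :
    ∀ᶠ x in 𝓝 (γ 0), f x = 0 → ∃ s, |s| < δ ∧ γ s = x := by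
  obtain ⟨l, e, hpe, he, hl⟩ := exists_straightening hf hreg
  have hγc : Continuous γ := continuous_iff_continuousAt.2 fun t ↦ (hγ t).continuousAt
  have hder : ∀ t, HasDerivAt (fun t ↦ l (γ t)) (l (hamiltonianField f (γ t))) t := fun t ↦
    l.hasFDerivAt.comp_hasDerivAt t (hγ t)
  have hstrict : HasStrictDerivAt (fun t ↦ l (γ t)) (l (hamiltonianField f (γ 0))) 0 := by
    refine hasStrictDerivAt_of_hasDerivAt_of_continuousAt (Eventually.of_forall hder) ?_
    exact (l.continuous.comp ((continuous_hamiltonianField hf).comp hγc)).continuousAt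
  have hmap := hstrict.map_nhds_eq hl.ne'
  have hV : {s | |s| < δ ∧ γ s ∈ e.source} ∈ 𝓝 (0 : ℝ) := by
    refine inter_mem ?_ (hγc.continuousAt.preimage_mem_nhds (e.open_source.mem_nhds hpe))
    exact (continuous_abs.continuousAt (x := (0 : ℝ))).preimage_mem_nhds
      (by rw [abs_zero]; exact gt_mem_nhds hδ)
  have himg : (fun t ↦ l (γ t)) '' {s | |s| < δ ∧ γ s ∈ e.source} ∈ 𝓝 (l (γ 0)) := by
    rw [← hmap]
    exact image_mem_map hV
  filter_upwards [l.continuous.continuousAt.preimage_mem_nhds himg, e.open_source.mem_nhds hpe]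
    with x hx hxs hfx
  obtain ⟨s, ⟨hs, hss⟩, hsx⟩ := hx
  refine ⟨s, hs, e.injOn hss hxs ?_⟩
  have hsx : l (γ s) = l x := hsx
  rw [he, he, hsx, apply_integralCurve_hamiltonianField hf hγ s 0, h0, hfx]

/-- A bounded trajectory in a regular zero set is periodic. -/
theorem exists_pos_integralCurve_eq (hf : ContDiff ℝ 1 f)
    (hK : LipschitzWith K (hamiltonianField f)) (hL : ∀ x, ‖hamiltonianField f x‖ ≤ L)
    (hreg : ∀ p, f p = 0 → fderiv ℝ f p ≠ 0) {γ : ℝ → ℝ × ℝ}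
    (hγ : ∀ t, HasDerivAt γ (hamiltonianField f (γ t)) t) (h0 : f (γ 0) = 0)
    {S : Set (ℝ × ℝ)} (hS : IsCompact S) (hγS : ∀ t, 0 ≤ t → γ t ∈ S) :
    ∃ T, 0 < T ∧ γ T = γ 0 := by
  obtain ⟨q, -, φ, hφ, hq⟩ := hS.tendsto_subseq (x := fun k : ℕ ↦ γ k)
    (fun k ↦ hγS k (Nat.cast_nonneg k))
  have hz : ∀ t, f (γ t) = 0 := fun t ↦
    (apply_integralCurve_hamiltonianField hf hγ t 0).trans h0
  have hfq : f q = 0 := by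
    refine tendsto_nhds_unique ((hf.continuous.tendsto q).comp hq) ?_
    simp only [Function.comp_def, hz]
    exact tendsto_const_nhds
  obtain ⟨η, rfl, hη⟩ := exists_global_integralCurve hK hL q
  have hev := hq.eventually
    (eventually_exists_integralCurve_eq hf hη hfq (hreg _ hfq) (δ := 1 / 2) (by norm_num))
  obtain ⟨N, hN⟩ := eventually_atTop.1 hev
  obtain ⟨s, hs, hs'⟩ := hN N le_rfl (hz _)
  obtain ⟨u, hu, hu'⟩ := hN (N + 1) (Nat.le_succ N) (hz _)
  have hlt : ((φ N : ℕ) : ℝ) + 1 ≤ (φ (N + 1) : ℕ) := by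
    exact_mod_cast hφ (Nat.lt_succ_self N)
  refine ⟨φ (N + 1) - u - φ N + s, by linarith [abs_lt.1 hs, abs_lt.1 hu, (abs_lt.1 hs).1,
    (abs_lt.1 hu).2], ?_⟩
  have a1 := integralCurve_unique hK hγ hη (s := φ N) (t := s) hs'.symm (-φ N)
  have a2 := integralCurve_unique hK hγ hη (s := φ (N + 1)) (t := u) hu'.symm (s - u - φ N)
  rw [neg_add_cancel] at a1
  rw [a1, show (φ (N + 1) : ℝ) - u - φ N + s = s - u - φ N + φ (N + 1) by ring, a2]
  congr 1
  ring

/-- If a line transverse to the zero set passes through a common boundary point of two nodal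
domains, the first one being bounded, it contains a second such point. -/
theorem IsNodalDomain.exists_ne_mem_closure {Ω Ω' : Set (ℝ × ℝ)} (hf : ContDiff ℝ 1 f)
    (hK : LipschitzWith K (hamiltonianField f)) (hL : ∀ x, ‖hamiltonianField f x‖ ≤ L)
    (hreg : ∀ p, f p = 0 → fderiv ℝ f p ≠ 0) (h : IsNodalDomain f Ω) (h' : IsNodalDomain f Ω')
    (hb : Bornology.IsBounded Ω) (hp : f p = 0) (hpΩ : p ∈ closure Ω) (hpΩ' : p ∈ closure Ω')
    (l : ℝ × ℝ →L[ℝ] ℝ) (hl : l (hamiltonianField f p) ≠ 0) :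
    ∃ q, q ≠ p ∧ q ∈ closure Ω ∧ q ∈ closure Ω' ∧ l q = l p := by
  have hinv : ∀ {Ω}, IsNodalDomain f Ω → ∀ γ : ℝ → ℝ × ℝ,
      (∀ t, HasDerivAt γ (hamiltonianField f (γ t)) t) → γ 0 ∈ Ω → ∀ t, γ t ∈ Ω := by
    intro Ω h γ hγ h0 t
    have hγc : Continuous γ := continuous_iff_continuousAt.2 fun t ↦ (hγ t).continuousAt
    refine h.subset_of_isPreconnected (isPreconnected_range hγc) ?_ h0 ⟨0, rfl⟩ ⟨t, rfl⟩
    rintro _ ⟨s, rfl⟩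
    rw [apply_integralCurve_hamiltonianField hf hγ s 0]
    exact h.ne_zero h0
  obtain ⟨γ, rfl, hγ⟩ := exists_global_integralCurve hK hL p
  have hγΩ : ∀ t, 0 ≤ t → γ t ∈ closure Ω := fun t ht ↦
    integralCurve_mem_closure hK hL (hinv h) hγ hpΩ ht
  have hγΩ' : ∀ t, 0 ≤ t → γ t ∈ closure Ω' := fun t ht ↦
    integralCurve_mem_closure hK hL (hinv h') hγ hpΩ' ht
  obtain ⟨T, hT, hTγ⟩ := exists_pos_integralCurve_eq hf hK hL hreg hγ hp
    hb.isCompact_closure hγΩ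
  have main : ∀ m : ℝ × ℝ →L[ℝ] ℝ, 0 < m (hamiltonianField f (γ 0)) →
      ∃ t, 0 < t ∧ m (γ t) = m (γ 0) ∧ γ t ≠ γ 0 := by
    intro m hm
    obtain ⟨t, ht0, -, ht, ht'⟩ := exists_zero_deriv_nonpos
      (f := fun t ↦ m (γ t) - m (γ 0)) (f' := fun t ↦ m (hamiltonianField f (γ t)))
      (fun t ↦ (m.hasFDerivAt.comp_hasDerivAt t (hγ t)).sub_const _) hT (sub_self _) hm
      (by rw [hTγ, sub_self]) (by rwa [hTγ])
    refine ⟨t, ht0, sub_eq_zero.1 ht, fun heq ↦ ?_⟩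
    rw [heq] at ht'
    exact absurd hm (not_lt.2 ht')
  rcases lt_or_gt_of_ne hl with hneg | hpos
  · obtain ⟨t, ht, h1, h2⟩ := main (-l) (by simpa using hneg)
    exact ⟨γ t, h2, hγΩ t ht.le, hγΩ' t ht.le, by simpa using h1⟩
  · obtain ⟨t, ht, h1, h2⟩ := main l hpos
    exact ⟨γ t, h2, hγΩ t ht.le, hγΩ' t ht.le, h1⟩

end Trajectories

end NodalDomain

section Periodic

open Set NNReal

/-- Invariance under translation by `ℤ²`. -/
def IsLatticePeriodic {F : Type*} (g : ℝ × ℝ → F) : Prop :=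
  ∀ (p : ℝ × ℝ) (v : ℤ × ℤ), g (p.1 + (v.1 : ℝ), p.2 + (v.2 : ℝ)) = g p

namespace IsLatticePeriodic

theorem exists_norm_le {F : Type*} [NormedAddCommGroup F] {g : ℝ × ℝ → F}
    (hg : IsLatticePeriodic g) (hc : Continuous g) : ∃ M : ℝ≥0, ∀ p, ‖g p‖ ≤ M := by
  obtain ⟨M, hM⟩ := ((isCompact_Icc (a := (0 : ℝ)) (b := 1)).prod
    (isCompact_Icc (a := (0 : ℝ)) (b := 1))).exists_bound_of_continuousOn hc.continuousOn
  refine ⟨M.toNNReal, fun p ↦ ?_⟩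
  have h := hg p (-⌊p.1⌋, -⌊p.2⌋)
  push_cast at h
  rw [← h]
  refine (hM _ ⟨?_, ?_⟩).trans (le_coe_toNNReal M)
  · exact ⟨by linarith [Int.floor_le p.1], by linarith [Int.lt_floor_add_one p.1]⟩
  · exact ⟨by linarith [Int.floor_le p.2], by linarith [Int.lt_floor_add_one p.2]⟩

theorem fderiv {F : Type*} [NormedAddCommGroup F] [NormedSpace ℝ F] {g : ℝ × ℝ → F}
    (hg : IsLatticePeriodic g) : IsLatticePeriodic (fderiv ℝ g) := by
  intro p v
  have h : (fun q ↦ g (q + ((v.1 : ℝ), (v.2 : ℝ)))) = g := funext fun q ↦ hg q v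
  have := fderiv_comp_add_right (𝕜 := ℝ) (f := g) (x := p) ((v.1 : ℝ), (v.2 : ℝ))
  rw [h] at this
  exact this.symm

theorem hamiltonianField {f : ℝ × ℝ → ℝ} (hf : IsLatticePeriodic f) :
    IsLatticePeriodic (hamiltonianField f) := by
  intro p v
  simp only [_root_.hamiltonianField, hf.fderiv p v]

theorem exists_bounds_hamiltonianField {f : ℝ × ℝ → ℝ} (hper : IsLatticePeriodic f)
    (hf : ContDiff ℝ 2 f) : ∃ K L : ℝ≥0, LipschitzWith K (_root_.hamiltonianField f) ∧
      ∀ x, ‖_root_.hamiltonianField f x‖ ≤ L := by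
  have hX : ContDiff ℝ 1 (_root_.hamiltonianField f) := by
    have h1 : ContDiff ℝ 1 (_root_.fderiv ℝ f) := hf.fderiv_right (by norm_num)
    exact (h1.clm_apply contDiff_const).prodMk (h1.clm_apply contDiff_const).neg
  obtain ⟨L, hL⟩ := hper.hamiltonianField.exists_norm_le hX.continuous
  obtain ⟨K, hK⟩ := hper.hamiltonianField.fderiv.exists_norm_le (hX.continuous_fderiv one_ne_zero)
  exact ⟨K, L, lipschitzWith_of_nnnorm_fderiv_le (𝕜 := ℝ) (hX.differentiable one_ne_zero)
    (fun x ↦ hK x), hL⟩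

end IsLatticePeriodic

end Periodic

section Strip

open Set Filter Topology

theorem IsLocalMax.deriv_deriv_nonpos {g : ℝ → ℝ} {t : ℝ} (h : IsLocalMax g t)
    (hg : ContinuousAt g t) : deriv (deriv g) t ≤ 0 := by
  by_contra! hpos
  have hmin := isLocalMin_of_deriv_deriv_pos hpos h.deriv_eq_zero hg
  have hconst : g =ᶠ[𝓝 t] fun _ ↦ g t := by
    filter_upwards [h, hmin] with s h1 h2 using le_antisymm h1 h2
  have := hconst.deriv.deriv_eq
  simp at this
  exact absurd hpos (by rw [this]; exact lt_irrefl _)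

theorem deriv_deriv_add_le_of_isLocalMax {φ : ℝ → ℝ} (hφ : ContDiff ℝ 2 φ) {σ M A B t : ℝ}
    (h : IsLocalMax (fun s ↦ σ * φ s - M * cos (A * s + B)) t) :
    σ * deriv (fun s ↦ deriv φ s) t + M * A ^ 2 * cos (A * t + B) ≤ 0 := by
  have hd1 : Differentiable ℝ φ := hφ.differentiable two_ne_zero
  have hd2 : Differentiable ℝ (deriv φ) := by
    have : ContDiff ℝ 1 (deriv φ) := ((contDiff_succ_iff_deriv (n := 1)).1 hφ).2.2
    exact this.differentiable one_ne_zero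
  have lin : ∀ s, HasDerivAt (fun s ↦ A * s + B) A s := fun s ↦ by
    simpa using ((hasDerivAt_id s).const_mul A).add_const B
  have h1 : deriv (fun s ↦ σ * φ s - M * cos (A * s + B)) =
      fun s ↦ σ * deriv φ s + M * A * sin (A * s + B) := by
    funext s
    have := ((hd1 s).hasDerivAt.const_mul σ).sub (((lin s).cos).const_mul M)
    refine (HasDerivAt.deriv this).trans ?_
    ring
  have h2 : deriv (fun s ↦ σ * deriv φ s + M * A * sin (A * s + B)) t =
      σ * deriv (fun s ↦ deriv φ s) t + M * A ^ 2 * cos (A * t + B) := by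
    have := ((hd2 t).hasDerivAt.const_mul σ).add (((lin t).sin).const_mul (M * A))
    refine (HasDerivAt.deriv this).trans ?_
    ring
  rw [← h2, ← h1]
  refine h.deriv_deriv_nonpos (Continuous.continuousAt ?_)
  have := hd1.continuous
  fun_prop

/-- A bounded nodal domain of an eigenfunction does not fit in a thin strip. -/
theorem IsNodalDomain.mul_le_of_subset_strip {ψ : ℝ × ℝ → ℝ} {Ω : Set (ℝ × ℝ)}
    (hψ : ContDiff ℝ 2 ψ) (h : IsNodalDomain ψ Ω) (hb : Bornology.IsBounded Ω) {lam : ℝ}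
    (hlap : ∀ p, laplacian2 ψ p = -lam * ψ p) {a b c₁ c₂ μ : ℝ}
    (hstrip : ∀ x ∈ Ω, c₁ ≤ a * x.1 + b * x.2 ∧ a * x.1 + b * x.2 ≤ c₂) (hμ : 0 < μ)
    (hμc : μ * (c₂ - c₁) < π) : μ ^ 2 * (a ^ 2 + b ^ 2) ≤ lam := by
  by_contra! hlt
  obtain ⟨z, hz⟩ := h.nonempty
  obtain ⟨σ, hσ⟩ : ∃ σ : ℝ, ∀ x ∈ Ω, 0 < σ * ψ x :=
    ⟨ψ z, fun x hx ↦ h.mul_pos hψ.continuous hz hx⟩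
  set F : ℝ × ℝ → ℝ := fun x ↦ cos (μ * (a * x.1 + b * x.2 - (c₁ + c₂) / 2)) with hF
  have hFc : Continuous F := by fun_prop
  have hFpos : ∀ x ∈ closure Ω, 0 < F x := by
    intro x hx
    have hcl : closure Ω ⊆ (fun x : ℝ × ℝ ↦ a * x.1 + b * x.2) ⁻¹' Icc c₁ c₂ :=
      closure_minimal hstrip (isClosed_Icc.preimage (by fun_prop))
    obtain ⟨h1, h2⟩ := hcl hx
    apply cos_pos_of_mem_Ioo
    constructor <;> nlinarith
  obtain ⟨p, hp, hmax⟩ := hb.isCompact_closure.exists_isMaxOn (f := fun x ↦ σ * ψ x / F x)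
    (h.nonempty.mono subset_closure)
    (((continuous_const.mul hψ.continuous).continuousOn).div hFc.continuousOn
      (fun x hx ↦ (hFpos x hx).ne'))
  set M := σ * ψ p / F p with hM
  have hMpos : 0 < M := (div_pos (hσ z hz) (hFpos z (subset_closure hz))).trans_le
    (hmax (subset_closure hz))
  have hψp : σ * ψ p = M * F p := by
    rw [hM, div_mul_cancel₀ _ (hFpos p hp).ne']
  have hpΩ : p ∈ Ω := by
    refine h.mem_of_mem_closure hp fun h0 ↦ ?_
    rw [h0, mul_zero] at hψp
    exact (_root_.mul_pos hMpos (hFpos p hp)).ne hψp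
  have hloc : IsLocalMax (fun x ↦ σ * ψ x - M * F x) p := by
    filter_upwards [(h.isOpen hψ.continuous).mem_nhds hpΩ] with x hx
    have hx' := hFpos x (subset_closure hx)
    have : σ * ψ x / F x ≤ M := hmax (subset_closure hx)
    rw [div_le_iff₀ hx'] at this
    rw [hψp, sub_self]
    linarith
  have l1 : IsLocalMax (fun s ↦ σ * ψ (s, p.2) -
      M * cos (μ * a * s + μ * (b * p.2 - (c₁ + c₂) / 2))) p.1 := by
    have := hloc.comp_continuous (b := p.1) (g := fun s : ℝ ↦ (s, p.2))
      (by fun_prop : Continuous fun s : ℝ ↦ (s, p.2)).continuousAt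
    convert this using 1
    funext s
    simp only [hF, Function.comp_def]
    ring_nf
  have l2 : IsLocalMax (fun s ↦ σ * ψ (p.1, s) -
      M * cos (μ * b * s + μ * (a * p.1 - (c₁ + c₂) / 2))) p.2 := by
    have := hloc.comp_continuous (b := p.2) (g := fun s : ℝ ↦ (p.1, s))
      (by fun_prop : Continuous fun s : ℝ ↦ (p.1, s)).continuousAt
    convert this using 1
    funext s
    simp only [hF, Function.comp_def]
    ring_nf
  have d1 := deriv_deriv_add_le_of_isLocalMax
    (hψ.comp (contDiff_id.prodMk contDiff_const)) l1
  have d2 := deriv_deriv_add_le_of_isLocalMax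
    (hψ.comp (contDiff_const.prodMk contDiff_id)) l2
  have e1 : cos (μ * a * p.1 + μ * (b * p.2 - (c₁ + c₂) / 2)) = F p := by
    simp only [hF]; congr 1; ring
  have e2 : cos (μ * b * p.2 + μ * (a * p.1 - (c₁ + c₂) / 2)) = F p := by
    simp only [hF]; congr 1; ring
  rw [e1] at d1
  rw [e2] at d2
  have hl := hlap p
  unfold laplacian2 at hl
  simp only [Function.comp_def, id] at d1 d2
  have hFp := hFpos p hp
  have key : σ * (-lam * ψ p) + M * (μ ^ 2 * (a ^ 2 + b ^ 2)) * F p ≤ 0 := by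
    rw [← hl]
    nlinarith
  have : M * F p * (μ ^ 2 * (a ^ 2 + b ^ 2) - lam) ≤ 0 := by
    have e3 : σ * (-lam * ψ p) = -lam * (M * F p) := by rw [← hψp]; ring
    rw [e3] at key
    linarith
  have := _root_.mul_pos (_root_.mul_pos hMpos hFp) (sub_pos.2 hlt)
  linarith

end Strip

section Fourier

open Set MeasureTheory intervalIntegral

/-- The character `x ↦ exp (2πikx)` of `ℝ/ℤ`. -/
noncomputable def charZ (k : ℤ) (x : ℝ) : ℂ := Complex.exp (2 * π * Complex.I * k * x)

theorem continuous_charZ (k : ℤ) : Continuous (charZ k) := by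
  unfold charZ; fun_prop

theorem charZ_eq_one (k m : ℤ) : charZ k m = 1 := by
  rw [charZ, Complex.exp_eq_one_iff]
  exact ⟨k * m, by push_cast; ring⟩

theorem charZ_add (k : ℤ) (x y : ℝ) : charZ k (x + y) = charZ k x * charZ k y := by
  rw [charZ, charZ, charZ, ← Complex.exp_add]
  push_cast
  ring_nf

theorem hasDerivAt_charZ (k : ℤ) (x : ℝ) :
    HasDerivAt (charZ k) (2 * π * Complex.I * k * charZ k x) x := by
  have h : HasDerivAt (fun x : ℝ ↦ (2 * π * Complex.I * k) * (x : ℂ))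
      (2 * π * Complex.I * k) x := by
    simpa using (Complex.ofRealCLM.hasDerivAt (x := x)).const_mul (2 * π * Complex.I * k)
  have := h.cexp
  rwa [mul_comm (Complex.exp _)] at this

theorem eq_sum_charZ {g : ℝ → ℂ} (hg : Continuous g) (hper : Function.Periodic g 1)
    (S : Finset ℤ) (hS : ∀ k ∉ S, ∫ x in (0 : ℝ)..1, charZ (-k) x * g x = 0) (x : ℝ) :
    g x = ∑ k ∈ S, (∫ y in (0 : ℝ)..1, charZ (-k) y * g y) * charZ k x := by
  let G : C(AddCircle (1 : ℝ), ℂ) := ⟨hper.lift, continuous_coinduced_dom.2 hg⟩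
  have hcoef : ∀ k, fourierCoeff G k = ∫ y in (0 : ℝ)..1, charZ (-k) y * g y := by
    intro k
    rw [fourierCoeff_eq_intervalIntegral G k 0]
    simp only [zero_add, div_one, one_smul]
    refine intervalIntegral.integral_congr fun y _ ↦ ?_
    simp only [smul_eq_mul, fourier_coe_apply, charZ]
    congr 2
    simp
  have hsum : Summable (fourierCoeff G) :=
    summable_of_ne_finset_zero (s := S) fun k hk ↦ by rw [hcoef, hS k hk]
  have h1 := has_pointwise_sum_fourier_series_of_summable hsum (x : AddCircle (1 : ℝ))
  have h2 := hasSum_sum_of_ne_finset_zero (s := S) (L := .unconditional ℤ)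
    (f := fun k ↦ fourierCoeff G k • fourier k (x : AddCircle (1 : ℝ)))
    fun k hk ↦ by rw [hcoef, hS k hk, zero_smul]
  have h3 := HasSum.unique h1 h2
  rw [show G (x : AddCircle (1 : ℝ)) = g x from rfl] at h3
  rw [h3]
  refine Finset.sum_congr rfl fun k _ ↦ ?_
  rw [hcoef, fourier_coe_apply, charZ]
  simp

theorem integral_charZ_mul_deriv {g g' : ℝ → ℂ} (hg : ∀ x, HasDerivAt g (g' x) x)
    (hg' : Continuous g') (hper : Function.Periodic g 1) (k : ℤ) :
    ∫ x in (0 : ℝ)..1, charZ (-k) x * g' x =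
      2 * π * Complex.I * k * ∫ x in (0 : ℝ)..1, charZ (-k) x * g x := by
  have hc : Continuous g := continuous_iff_continuousAt.2 fun x ↦ (hg x).continuousAt
  rw [intervalIntegral.integral_mul_deriv_eq_deriv_mul (fun x _ ↦ hasDerivAt_charZ (-k) x)
    (fun x _ ↦ hg x) ((continuous_const.mul (continuous_charZ _)).intervalIntegrable _ _)
    (hg'.intervalIntegrable _ _)]
  have e1 : g 1 = g 0 := by simpa using hper 0
  have e2 : charZ (-k) 1 = 1 := by simpa using charZ_eq_one (-k) 1
  have e3 : charZ (-k) 0 = 1 := by simpa using charZ_eq_one (-k) 0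
  rw [e1, e2, e3, sub_self, zero_sub, ← intervalIntegral.integral_neg,
    ← intervalIntegral.integral_const_mul]
  refine intervalIntegral.integral_congr fun x _ ↦ ?_
  push_cast
  ring

theorem integral_charZ_mul_deriv_deriv {u : ℝ → ℝ} (hu : ContDiff ℝ 2 u)
    (hper : Function.Periodic u 1) (k : ℤ) :
    ∫ x in (0 : ℝ)..1, charZ (-k) x * ((deriv (deriv u) x : ℝ) : ℂ) =
      -(4 * π ^ 2 * k ^ 2) * ∫ x in (0 : ℝ)..1, charZ (-k) x * (u x : ℂ) := by
  have hu1 : ContDiff ℝ 1 (deriv u) := ((contDiff_succ_iff_deriv (n := 1)).1 hu).2.2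
  have hu2 : Continuous (deriv (deriv u)) := hu1.continuous_deriv le_rfl
  have hper1 : Function.Periodic (deriv u) 1 := fun x ↦ by
    rw [← deriv_comp_add_const]
    congr 1
    exact funext hper
  rw [integral_charZ_mul_deriv (g := fun x ↦ ((deriv u x : ℝ) : ℂ))
      (fun x ↦ ((hu1.differentiable one_ne_zero x).hasDerivAt).ofReal_comp)
      (Complex.continuous_ofReal.comp hu2) (fun x ↦ by simp [hper1 x]),
    integral_charZ_mul_deriv (g := fun x ↦ (u x : ℂ))
      (fun x ↦ ((hu.differentiable two_ne_zero x).hasDerivAt).ofReal_comp)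
      (Complex.continuous_ofReal.comp hu1.continuous) (fun x ↦ by simp [hper x])]
  ring_nf
  rw [Complex.I_sq]
  ring

/-- The lattice points on the circle of radius `√n`. -/
noncomputable def latticeCircle (n : ℕ) : Finset (ℤ × ℤ) :=
  (Finset.Icc (-(n : ℤ)) n ×ˢ Finset.Icc (-(n : ℤ)) n).filter fun ξ ↦ ξ.1 ^ 2 + ξ.2 ^ 2 = n

theorem mem_latticeCircle {n : ℕ} {ξ : ℤ × ℤ} :
    ξ ∈ latticeCircle n ↔ ξ.1 ^ 2 + ξ.2 ^ 2 = n := by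
  simp only [latticeCircle, Finset.mem_filter, Finset.mem_product, Finset.mem_Icc,
    and_iff_right_iff_imp]
  intro h
  have h1 := Int.le_self_sq ξ.1
  have h2 := Int.le_self_sq ξ.2
  have h3 := Int.le_self_sq (-ξ.1)
  have h4 := Int.le_self_sq (-ξ.2)
  refine ⟨⟨?_, ?_⟩, ?_, ?_⟩ <;> nlinarith [sq_nonneg ξ.1, sq_nonneg ξ.2]

/-- The Fourier coefficient of a function on `ℝ²/ℤ²`. -/
noncomputable def fourierCoeff2 (ψ : ℝ × ℝ → ℝ) (ξ : ℤ × ℤ) : ℂ :=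
  ∫ y in (0 : ℝ)..1, charZ (-ξ.2) y * ∫ x in (0 : ℝ)..1, charZ (-ξ.1) x * (ψ (x, y) : ℂ)

theorem fourierCoeff2_swap {ψ : ℝ × ℝ → ℝ} (hψ : Continuous ψ) (ξ : ℤ × ℤ) :
    fourierCoeff2 ψ ξ = ∫ x in (0 : ℝ)..1, charZ (-ξ.1) x *
      ∫ y in (0 : ℝ)..1, charZ (-ξ.2) y * (ψ (x, y) : ℂ) := by
  have h1 := continuous_charZ (-ξ.1)
  have h2 := continuous_charZ (-ξ.2)
  simp only [fourierCoeff2, ← intervalIntegral.integral_const_mul]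
  simp only [intervalIntegral.integral_of_le zero_le_one]
  rw [integral_integral_swap]
  · refine integral_congr_ae (ae_of_all _ fun x ↦ integral_congr_ae (ae_of_all _ fun y ↦ ?_))
    ring
  · rw [Measure.prod_restrict]
    refine IntegrableOn.mono_set ?_ (prod_mono Ioc_subset_Icc_self Ioc_subset_Icc_self)
    refine ContinuousOn.integrableOn_compact (isCompact_Icc.prod isCompact_Icc)
      (Continuous.continuousOn ?_)
    simp only [Function.uncurry_def]
    fun_prop

theorem continuous_integral_charZ_mul {ψ : ℝ × ℝ → ℝ} (hψ : Continuous ψ) (k : ℤ) :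
    Continuous fun y ↦ ∫ x in (0 : ℝ)..1, charZ k x * (ψ (x, y) : ℂ) := by
  have h1 := continuous_charZ k
  apply intervalIntegral.continuous_parametric_intervalIntegral_of_continuous'
  simp only [Function.uncurry_def]
  fun_prop

theorem fourierCoeff2_add {ψ₁ ψ₂ : ℝ × ℝ → ℝ} (h₁ : Continuous ψ₁) (h₂ : Continuous ψ₂)
    (ξ : ℤ × ℤ) : fourierCoeff2 (fun p ↦ ψ₁ p + ψ₂ p) ξ =
      fourierCoeff2 ψ₁ ξ + fourierCoeff2 ψ₂ ξ := by
  have hc := continuous_charZ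
  simp only [fourierCoeff2]
  have hi : ∀ {g : ℝ → ℂ}, Continuous g → ∀ k, IntervalIntegrable (fun x ↦ charZ k x * g x)
      volume 0 1 := fun hg k ↦ ((hc k).mul hg).intervalIntegrable _ _
  rw [← intervalIntegral.integral_add (hi (continuous_integral_charZ_mul h₁ _) _)
    (hi (continuous_integral_charZ_mul h₂ _) _)]
  refine intervalIntegral.integral_congr fun y _ ↦ ?_
  rw [← mul_add, ← intervalIntegral.integral_add
    (hi (g := fun x ↦ (ψ₁ (x, y) : ℂ)) (by fun_prop) _)
    (hi (g := fun x ↦ (ψ₂ (x, y) : ℂ)) (by fun_prop) _)]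
  congr 1
  refine intervalIntegral.integral_congr fun x _ ↦ ?_
  push_cast
  ring

theorem fourierCoeff2_const_mul (ψ : ℝ × ℝ → ℝ) (r : ℝ) (ξ : ℤ × ℤ) :
    fourierCoeff2 (fun p ↦ r * ψ p) ξ = r * fourierCoeff2 ψ ξ := by
  simp only [fourierCoeff2, ← intervalIntegral.integral_const_mul]
  refine intervalIntegral.integral_congr fun y _ ↦ intervalIntegral.integral_congr fun x _ ↦ ?_
  push_cast
  ring

theorem continuous_deriv_deriv_fst {ψ : ℝ × ℝ → ℝ} (hψ : ContDiff ℝ 2 ψ) :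
    Continuous fun p : ℝ × ℝ ↦ deriv (deriv fun x ↦ ψ (x, p.2)) p.1 := by
  have key : ∀ {g : ℝ × ℝ → ℝ}, Differentiable ℝ g → ∀ x y,
      deriv (fun x ↦ g (x, y)) x = fderiv ℝ g (x, y) (1, 0) := fun hg x y ↦
    HasDerivAt.deriv <| (hg (x, y)).hasFDerivAt.comp_hasDerivAt x
      ((hasDerivAt_id x).prodMk (hasDerivAt_const x y))
  have h1 : ContDiff ℝ 1 fun p ↦ fderiv ℝ ψ p (1, 0) :=
    (hψ.fderiv_right (by norm_num)).clm_apply contDiff_const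
  have h2 : (fun p : ℝ × ℝ ↦ deriv (deriv fun x ↦ ψ (x, p.2)) p.1) =
      fun p ↦ fderiv ℝ (fun p ↦ fderiv ℝ ψ p (1, 0)) p (1, 0) := by
    funext p
    rw [← key (h1.differentiable one_ne_zero) p.1 p.2]
    congr 1
    funext x
    exact key (hψ.differentiable two_ne_zero) x p.2
  rw [h2]
  exact (h1.continuous_fderiv one_ne_zero).clm_apply continuous_const

theorem continuous_deriv_deriv_snd {ψ : ℝ × ℝ → ℝ} (hψ : ContDiff ℝ 2 ψ) :
    Continuous fun p : ℝ × ℝ ↦ deriv (deriv fun y ↦ ψ (p.1, y)) p.2 :=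
  (continuous_deriv_deriv_fst (ψ := ψ ∘ Prod.swap)
    (hψ.comp (contDiff_snd.prodMk contDiff_fst))).comp continuous_swap

theorem fourierCoeff2_eq_zero {ψ : ℝ × ℝ → ℝ} (hψ : ContDiff ℝ 2 ψ) (hper : IsLatticePeriodic ψ)
    {n : ℕ} (hlap : ∀ p, laplacian2 ψ p = -(4 * π ^ 2 * n) * ψ p) {ξ : ℤ × ℤ}
    (hξ : ξ ∉ latticeCircle n) : fourierCoeff2 ψ ξ = 0 := by
  have hx := continuous_deriv_deriv_fst hψ
  have hy := continuous_deriv_deriv_snd hψ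
  have e1 : fourierCoeff2 (fun p : ℝ × ℝ ↦ deriv (deriv fun x ↦ ψ (x, p.2)) p.1) ξ =
      -(4 * π ^ 2 * ξ.1 ^ 2) * fourierCoeff2 ψ ξ := by
    rw [fourierCoeff2, fourierCoeff2, ← intervalIntegral.integral_const_mul]
    refine intervalIntegral.integral_congr fun y _ ↦ ?_
    simp only
    rw [integral_charZ_mul_deriv_deriv (u := fun x ↦ ψ (x, y))
      (hψ.comp (contDiff_id.prodMk contDiff_const)) (fun x ↦ by simpa using hper (x, y) (1, 0))]
    ring
  have e2 : fourierCoeff2 (fun p : ℝ × ℝ ↦ deriv (deriv fun y ↦ ψ (p.1, y)) p.2) ξ =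
      -(4 * π ^ 2 * ξ.2 ^ 2) * fourierCoeff2 ψ ξ := by
    rw [fourierCoeff2_swap hy, fourierCoeff2_swap hψ.continuous,
      ← intervalIntegral.integral_const_mul]
    refine intervalIntegral.integral_congr fun x _ ↦ ?_
    simp only
    rw [integral_charZ_mul_deriv_deriv (u := fun y ↦ ψ (x, y))
      (hψ.comp (contDiff_const.prodMk contDiff_id)) (fun y ↦ by simpa using hper (x, y) (0, 1))]
    ring
  have e3 : fourierCoeff2 (fun p : ℝ × ℝ ↦ deriv (deriv fun x ↦ ψ (x, p.2)) p.1 +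
      deriv (deriv fun y ↦ ψ (p.1, y)) p.2) ξ = -(4 * π ^ 2 * n) * fourierCoeff2 ψ ξ := by
    have := fourierCoeff2_const_mul ψ (-(4 * π ^ 2 * n)) ξ
    push_cast at this
    rw [← this]
    congr 1
    exact funext hlap
  rw [fourierCoeff2_add hx hy, e1, e2] at e3
  have e4 : (4 * π ^ 2 * ((ξ.1 ^ 2 + ξ.2 ^ 2 - n : ℤ) : ℂ)) * fourierCoeff2 ψ ξ = 0 := by
    push_cast
    linear_combination -e3
  refine (mul_eq_zero.1 e4).resolve_left (mul_ne_zero ?_ ?_)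
  · norm_cast
    positivity
  · rw [Int.cast_ne_zero, sub_ne_zero]
    exact fun h ↦ hξ (mem_latticeCircle.2 h)

/-- A toral eigenfunction is a trigonometric polynomial. -/
theorem exists_eq_sum_charZ {ψ : ℝ × ℝ → ℝ} (hψ : ContDiff ℝ 2 ψ) (hper : IsLatticePeriodic ψ)
    {n : ℕ} (hlap : ∀ p, laplacian2 ψ p = -(4 * π ^ 2 * n) * ψ p) :
    ∃ c : ℤ × ℤ → ℂ, ∀ p, (ψ p : ℂ) =
      ∑ ξ ∈ latticeCircle n, c ξ * (charZ ξ.1 p.1 * charZ ξ.2 p.2) := by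
  refine ⟨fourierCoeff2 ψ, fun p ↦ ?_⟩
  have hc := hψ.continuous
  set I := Finset.Icc (-(n : ℤ)) n
  have hmem : ∀ {a b : ℤ}, a ∉ I ∨ b ∉ I → (a, b) ∉ latticeCircle n := by
    intro a b hab h
    have := (Finset.mem_filter.1 h).1
    rw [Finset.mem_product] at this
    exact hab.elim (fun h ↦ h this.1) (fun h ↦ h this.2)
  have hinner : ∀ a y, ∫ x in (0 : ℝ)..1, charZ (-a) x * (ψ (x, y) : ℂ) =
      ∑ b ∈ I, fourierCoeff2 ψ (a, b) * charZ b y := by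
    intro a y
    simp only [fourierCoeff2]
    refine eq_sum_charZ (continuous_integral_charZ_mul hc (-a)) (fun y ↦ ?_) I (fun b hb ↦ ?_) y
    · refine intervalIntegral.integral_congr fun x _ ↦ ?_
      have := hper (x, y) (0, 1)
      simp only [Int.cast_zero, add_zero, Int.cast_one] at this
      simp only [this]
    · have := fourierCoeff2_eq_zero hψ hper hlap (ξ := (a, b)) (hmem (.inr hb))
      rwa [fourierCoeff2] at this
  have houter : (ψ p : ℂ) = ∑ a ∈ I, (∫ x in (0 : ℝ)..1, charZ (-a) x * (ψ (x, p.2) : ℂ)) *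
      charZ a p.1 := by
    refine eq_sum_charZ (g := fun x ↦ (ψ (x, p.2) : ℂ)) (by fun_prop) (fun x ↦ ?_) I
      (fun a ha ↦ ?_) p.1
    · have := hper (x, p.2) (1, 0)
      simp only [Int.cast_zero, add_zero, Int.cast_one] at this
      simp only [this]
    · rw [hinner]
      exact Finset.sum_eq_zero fun b _ ↦ by
        rw [fourierCoeff2_eq_zero hψ hper hlap (hmem (.inl ha)), zero_mul]
  rw [houter, latticeCircle, Finset.sum_filter_of_ne, Finset.sum_product]
  · refine Finset.sum_congr rfl fun a _ ↦ ?_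
    rw [hinner, Finset.sum_mul]
    exact Finset.sum_congr rfl fun b _ ↦ by ring
  · intro ξ _ h
    by_contra hn
    exact h (by rw [fourierCoeff2_eq_zero hψ hper hlap fun h ↦ hn (mem_latticeCircle.1 h),
      zero_mul])

end Fourier

section Restriction

open Polynomial

theorem charZ_add_left (k l : ℤ) (x : ℝ) : charZ (k + l) x = charZ k x * charZ l x := by
  rw [charZ, charZ, charZ, ← Complex.exp_add]
  push_cast
  ring_nf

theorem charZ_mul_intCast (k m : ℤ) (x : ℝ) : charZ k (x * m) = charZ (k * m) x := by
  rw [charZ, charZ]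
  push_cast
  ring_nf

theorem charZ_natCast (m : ℕ) (x : ℝ) : charZ m x = charZ 1 x ^ m := by
  rw [charZ, charZ, ← Complex.exp_nat_mul]
  push_cast
  ring_nf

theorem charZ_ne_zero (k : ℤ) (x : ℝ) : charZ k x ≠ 0 := Complex.exp_ne_zero _

theorem charZ_one_eq_iff {s t : ℝ} : charZ 1 s = charZ 1 t ↔ ∃ k : ℤ, s = t + k := by
  rw [charZ, charZ, Complex.exp_eq_exp_iff_exists_int]
  refine exists_congr fun k ↦ ?_
  have h : (2 * π * Complex.I : ℂ) ≠ 0 := Complex.two_pi_I_ne_zero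
  rw [show 2 * π * Complex.I * (1 : ℤ) * (s : ℂ) = s * (2 * π * Complex.I) by push_cast; ring,
    show 2 * π * Complex.I * (1 : ℤ) * (t : ℂ) + k * (2 * π * Complex.I) =
      ((t + k : ℝ) : ℂ) * (2 * π * Complex.I) by push_cast; ring,
    mul_left_inj' h, Complex.ofReal_inj]

/-- The polynomial `Q` in `exp (2πit)` represents `g` up to a factor of frequency `D`. -/
def IsTrigPolynomial (g : ℝ → ℝ) (D : ℕ) (Q : ℂ[X]) : Prop :=
  Q.natDegree ≤ 2 * D ∧ ∀ t, (g t : ℂ) * charZ D t = Q.eval (charZ 1 t)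

namespace IsTrigPolynomial

variable {g : ℝ → ℝ} {D : ℕ} {Q : ℂ[X]}

theorem isRoot (h : IsTrigPolynomial g D Q) {t : ℝ} (ht : g t = 0) : Q.IsRoot (charZ 1 t) := by
  rw [IsRoot, ← h.2 t, ht, Complex.ofReal_zero, zero_mul]

theorem ne_zero (h : IsTrigPolynomial g D Q) {t : ℝ} (ht : g t ≠ 0) : Q ≠ 0 := by
  rintro rfl
  have := h.2 t
  rw [eval_zero] at this
  exact mul_ne_zero (Complex.ofReal_ne_zero.2 ht) (charZ_ne_zero _ _) this

theorem one_lt_rootMultiplicity (h : IsTrigPolynomial g D Q) (hQ : Q ≠ 0) {t : ℝ}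
    (ht : g t = 0) (hd : HasDerivAt g 0 t) : 1 < Q.rootMultiplicity (charZ 1 t) := by
  rw [one_lt_rootMultiplicity_iff_isRoot hQ]
  refine ⟨h.isRoot ht, ?_⟩
  have h1 := hd.ofReal_comp.mul (hasDerivAt_charZ D t)
  have h2 := (Q.hasDerivAt (charZ 1 t)).comp t (hasDerivAt_charZ 1 t)
  have h3 : (fun t ↦ (g t : ℂ)) * charZ D = (fun x ↦ Q.eval x) ∘ charZ 1 := funext h.2
  rw [h3] at h1
  have h4 := h1.unique h2
  rw [ht] at h4
  simp only [Complex.ofReal_zero, zero_mul, add_zero] at h4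
  refine (mul_eq_zero.1 h4.symm).resolve_right (mul_ne_zero ?_ (charZ_ne_zero _ _))
  simp [Real.pi_ne_zero]

end IsTrigPolynomial

theorem exists_isTrigPolynomial {ψ : ℝ × ℝ → ℝ} (hψ : ContDiff ℝ 2 ψ) (hper : IsLatticePeriodic ψ)
    {n : ℕ} (hlap : ∀ p, laplacian2 ψ p = -(4 * π ^ 2 * n) * ψ p) (x₀ : ℝ × ℝ) (v : ℤ × ℤ) {D : ℕ}
    (hD : ∀ ξ ∈ latticeCircle n, |ξ.1 * v.1 + ξ.2 * v.2| ≤ D) :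
    ∃ Q, IsTrigPolynomial (fun t ↦ ψ (x₀.1 + t * v.1, x₀.2 + t * v.2)) D Q := by
  obtain ⟨c, hc⟩ := exists_eq_sum_charZ hψ hper hlap
  refine ⟨∑ ξ ∈ latticeCircle n, C (c ξ * (charZ ξ.1 x₀.1 * charZ ξ.2 x₀.2)) *
    X ^ (ξ.1 * v.1 + ξ.2 * v.2 + D).toNat, ?_, fun t ↦ ?_⟩
  · refine natDegree_sum_le_of_forall_le _ _ fun ξ hξ ↦ (natDegree_C_mul_X_pow_le _ _).trans ?_
    have := abs_le.1 (hD ξ hξ)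
    omega
  · simp only [hc, eval_finsetSum, eval_mul, eval_C, eval_pow, eval_X, Finset.sum_mul]
    refine Finset.sum_congr rfl fun ξ hξ ↦ ?_
    have := abs_le.1 (hD ξ hξ)
    rw [← charZ_natCast, Int.toNat_of_nonneg (by linarith), charZ_add_left, charZ_add_left,
      charZ_add, charZ_add, charZ_mul_intCast, charZ_mul_intCast]
    ring

end Restriction

section LineCount

open Set Filter Topology NNReal

/-- The affine parametrisation of a line with integral direction. -/
def latticeLine (x₀ : ℝ × ℝ) (v : ℤ × ℤ) (t : ℝ) : ℝ × ℝ := (x₀.1 + t * v.1, x₀.2 + t * v.2)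

variable {f : ℝ × ℝ → ℝ} {x₀ : ℝ × ℝ} {v : ℤ × ℤ}

theorem continuous_latticeLine : Continuous (latticeLine x₀ v) := by
  unfold latticeLine; fun_prop

theorem latticeLine_add_int (t : ℝ) (k : ℤ) : latticeLine x₀ v (t + k) =
    latticeLine x₀ v t + (((k * v.1 : ℤ) : ℝ), ((k * v.2 : ℤ) : ℝ)) := by
  ext <;> simp only [latticeLine, Prod.mk_add_mk] <;> push_cast <;> ring

theorem exists_eq_latticeLine (hv : v ≠ 0) {x : ℝ × ℝ} {t : ℝ}
    (h : -(v.2 : ℝ) * x.1 + v.1 * x.2 =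
      -(v.2 : ℝ) * (latticeLine x₀ v t).1 + v.1 * (latticeLine x₀ v t).2) :
    ∃ s, x = latticeLine x₀ v s := by
  have hv' : (v.1 : ℝ) ^ 2 + (v.2 : ℝ) ^ 2 ≠ 0 := by
    intro h0
    apply hv
    have h1 : (v.1 : ℝ) = 0 := by nlinarith [sq_nonneg (v.1 : ℝ), sq_nonneg (v.2 : ℝ)]
    have h2 : (v.2 : ℝ) = 0 := by nlinarith [sq_nonneg (v.1 : ℝ), sq_nonneg (v.2 : ℝ)]
    exact Prod.ext (by exact_mod_cast h1) (by exact_mod_cast h2)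
  simp only [latticeLine] at h
  refine ⟨((x.1 - x₀.1) * v.1 + (x.2 - x₀.2) * v.2) / ((v.1 : ℝ) ^ 2 + (v.2 : ℝ) ^ 2), ?_⟩
  ext <;> simp only [latticeLine] <;> field_simp
  · linear_combination -(v.2 : ℝ) * h
  · linear_combination (v.1 : ℝ) * h

theorem IsNodalDomain.eventually_mem {Ω : Set (ℝ × ℝ)} (hf : ContDiff ℝ 1 f)
    (h : IsNodalDomain f Ω) {p x : ℝ × ℝ} (hp : fderiv ℝ f p ≠ 0) (hpΩ : p ∈ closure Ω)
    (hx : x ∈ Ω) : ∀ᶠ q in 𝓝 p, 0 < f q * f x → q ∈ Ω := by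
  obtain ⟨U, hU, hUc⟩ := exists_nhds_forall_mem_connectedComponentIn hf hp
  obtain ⟨a, haU, ha⟩ := mem_closure_iff_nhds.1 hpΩ U hU
  filter_upwards [hU] with q hq hqx
  rw [h.eq_connectedComponentIn ha]
  refine hUc a haU q hq ?_
  have := h.mul_pos hf.continuous ha hx
  nlinarith [mul_self_pos.2 (h.ne_zero hx), _root_.mul_pos this hqx]

/-- A bounded nodal domain meeting a line has first and last boundary points on it. -/
theorem IsNodalDomain.exists_endpoints {Ω : Set (ℝ × ℝ)} (hf : Continuous f)
    (h : IsNodalDomain f Ω) (hb : Bornology.IsBounded Ω) (hv : v ≠ 0) {t₀ : ℝ}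
    (ht₀ : latticeLine x₀ v t₀ ∈ Ω) : ∃ e : Bool → ℝ, e false < e true ∧
      (∀ b, latticeLine x₀ v (e b) ∈ closure Ω ∧ f (latticeLine x₀ v (e b)) = 0) ∧
      ∀ t, latticeLine x₀ v t ∈ closure Ω → e false ≤ t ∧ t ≤ e true := by
  set T := latticeLine x₀ v ⁻¹' closure Ω
  have hcl : IsClosed T := isClosed_closure.preimage continuous_latticeLine
  have hTb : Bornology.IsBounded T := by
    obtain ⟨R, hR⟩ := hb.closure.exists_norm_le
    have hcase : v.1 ≠ 0 ∨ v.2 ≠ 0 := by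
      by_contra! h0
      exact hv (Prod.ext h0.1 h0.2)
    have key : ∀ {m : ℤ} (c : ℝ), m ≠ 0 → ∀ t : ℝ, ‖c + t * m‖ ≤ R → ‖t‖ ≤ R + ‖c‖ := by
      intro m c hm t ht
      have h1 : (1 : ℝ) ≤ |(m : ℝ)| := by exact_mod_cast Int.one_le_abs hm
      have h2 : ‖t * m‖ ≤ ‖c + t * m‖ + ‖c‖ := by
        have := norm_sub_le (c + t * m) c
        rwa [add_sub_cancel_left] at this
      rw [norm_mul, Real.norm_eq_abs (m : ℝ)] at h2
      nlinarith [norm_nonneg t]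
    rcases hcase with h1 | h1
    · exact isBounded_iff_forall_norm_le.2 ⟨_, fun t ht ↦
        key x₀.1 h1 t ((norm_fst_le (latticeLine x₀ v t)).trans (hR _ ht))⟩
    · exact isBounded_iff_forall_norm_le.2 ⟨_, fun t ht ↦
        key x₀.2 h1 t ((norm_snd_le (latticeLine x₀ v t)).trans (hR _ ht))⟩
  have hTc : IsCompact T := Metric.isCompact_of_isClosed_isBounded hcl hTb
  have ht₀T : t₀ ∈ T := subset_closure ht₀
  have hne : T.Nonempty := ⟨t₀, ht₀T⟩
  have hnhds : ∀ t ∈ T, f (latticeLine x₀ v t) ≠ 0 → T ∈ 𝓝 t := fun t ht hft ↦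
    mem_of_superset (continuous_latticeLine.continuousAt.preimage_mem_nhds
      ((h.isOpen hf).mem_nhds (h.mem_of_mem_closure ht hft))) (preimage_mono subset_closure)
  have ha := hTc.sInf_mem hne
  have hb' := hTc.sSup_mem hne
  have hle : ∀ t ∈ T, sInf T ≤ t ∧ t ≤ sSup T := fun t ht ↦
    ⟨csInf_le hTc.bddBelow ht, le_csSup hTc.bddAbove ht⟩
  have fa : f (latticeLine x₀ v (sInf T)) = 0 := by
    by_contra hfa
    obtain ⟨t, hlt, ht⟩ := ((frequently_lt_nhds (sInf T)).and_eventually (hnhds _ ha hfa)).exists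
    exact absurd (hle t ht).1 (not_le.2 hlt)
  have fb : f (latticeLine x₀ v (sSup T)) = 0 := by
    by_contra hfb
    obtain ⟨t, hlt, ht⟩ := ((frequently_gt_nhds (sSup T)).and_eventually (hnhds _ hb' hfb)).exists
    exact absurd (hle t ht).2 (not_le.2 hlt)
  refine ⟨fun b ↦ if b then sSup T else sInf T, ?_, ?_, fun t ht ↦ by simpa using hle t ht⟩
  · have h1 := hle t₀ ht₀T
    have h2 : sInf T ≠ t₀ := by
      rintro h2
      exact h.ne_zero ht₀ (h2 ▸ fa)
    simpa using (lt_of_le_of_ne h1.1 h2).trans_le h1.2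
  · rintro (_ | _)
    · simpa using ⟨ha, fa⟩
    · simpa using ⟨hb', fb⟩

end LineCount

section LineCount

open Set Filter Topology NNReal

variable {f : ℝ × ℝ → ℝ} {x₀ : ℝ × ℝ} {v : ℤ × ℤ}

theorem hasDerivAt_comp_latticeLine (hf : Differentiable ℝ f) (t : ℝ) :
    HasDerivAt (fun t ↦ f (latticeLine x₀ v t))
      (fderiv ℝ f (latticeLine x₀ v t) ((v.1 : ℝ), (v.2 : ℝ))) t := by
  have h : HasDerivAt (latticeLine x₀ v) ((v.1 : ℝ), (v.2 : ℝ)) t := by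
    have h1 := ((hasDerivAt_id t).mul_const (v.1 : ℝ)).const_add x₀.1
    have h2 := ((hasDerivAt_id t).mul_const (v.2 : ℝ)).const_add x₀.2
    rw [one_mul] at h1 h2
    exact h1.prodMk h2
  exact (hf _).hasFDerivAt.comp_hasDerivAt t h

theorem IsNodalDomain.eventually_latticeLine_mem {Ω : Set (ℝ × ℝ)} (hf : ContDiff ℝ 1 f)
    (h : IsNodalDomain f Ω) {t₀ m : ℝ} (hm : HasDerivAt (fun t ↦ f (latticeLine x₀ v t)) m t₀)
    (h0 : f (latticeLine x₀ v t₀) = 0) (hreg : fderiv ℝ f (latticeLine x₀ v t₀) ≠ 0)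
    (hcl : latticeLine x₀ v t₀ ∈ closure Ω) {x : ℝ × ℝ} (hx : x ∈ Ω) :
    ∀ᶠ t in 𝓝 t₀, 0 < m * f x * (t - t₀) → latticeLine x₀ v t ∈ Ω := by
  have h1 := continuous_latticeLine.continuousAt.eventually
    (h.eventually_mem hf hreg hcl hx)
  rcases eq_or_ne (m * f x) 0 with hmx | hmx
  · filter_upwards with t ht
    rw [hmx, zero_mul] at ht
    exact absurd ht (lt_irrefl _)
  have hd := hm.mul_const (m * f x * f x)
  have hpos : 0 < deriv (fun t ↦ f (latticeLine x₀ v t) * (m * f x * f x)) t₀ := by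
    rw [hd.deriv, show m * (m * f x * f x) = (m * f x) ^ 2 by ring]
    positivity
  filter_upwards [h1, eventually_nhdsWithin_sign_eq_of_deriv_pos hpos (by rw [h0, zero_mul])]
    with t ht hs hmt
  apply ht
  have hmx2 : 0 < (m * f x) ^ 2 := by positivity
  have hsgn : 0 < (t - t₀) * (f (latticeLine x₀ v t) * (m * f x * f x)) := by
    rcases lt_trichotomy (t - t₀) 0 with h2 | h2 | h2
    · rw [sign_neg h2, sign_eq_neg_one_iff] at hs
      exact mul_pos_of_neg_of_neg h2 hs
    · rw [h2, mul_zero] at hmt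
      exact absurd hmt (lt_irrefl _)
    · rw [sign_pos h2, sign_eq_one_iff] at hs
      exact _root_.mul_pos h2 hs
  have : 0 < (m * f x * (t - t₀)) * (f (latticeLine x₀ v t) * f x) := by
    calc _ < _ := hsgn
      _ = _ := by ring
  exact (pos_iff_pos_of_mul_pos this).1 hmt

/-- Two nodal domains of opposite sign sharing an extremal boundary point on a line touch the line
tangentially. -/
theorem IsNodalDomain.hasDerivAt_zero_of_extremal {Ω Ω' : Set (ℝ × ℝ)} (hf : ContDiff ℝ 2 f)
    (hper : IsLatticePeriodic f) (hreg : ∀ p, f p = 0 → fderiv ℝ f p ≠ 0) (hv : v ≠ 0)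
    (h : IsNodalDomain f Ω) (h' : IsNodalDomain f Ω') (hb : Bornology.IsBounded Ω) {t₀ : ℝ}
    (h0 : f (latticeLine x₀ v t₀) = 0) (hcl : latticeLine x₀ v t₀ ∈ closure Ω)
    (hcl' : latticeLine x₀ v t₀ ∈ closure Ω')
    (hext : (∀ t, latticeLine x₀ v t ∈ closure Ω → t₀ ≤ t) ∨
      ∀ t, latticeLine x₀ v t ∈ closure Ω → t ≤ t₀)
    (hext' : (∀ t, latticeLine x₀ v t ∈ closure Ω' → t₀ ≤ t) ∨
      ∀ t, latticeLine x₀ v t ∈ closure Ω' → t ≤ t₀)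
    {x y : ℝ × ℝ} (hx : x ∈ Ω) (hy : y ∈ Ω') (hxy : f x * f y < 0) :
    HasDerivAt (fun t ↦ f (latticeLine x₀ v t)) 0 t₀ := by
  have hf1 : ContDiff ℝ 1 f := hf.of_le one_le_two
  have hd := hasDerivAt_comp_latticeLine (x₀ := x₀) (v := v) (hf.differentiable two_ne_zero) t₀
  set m := fderiv ℝ f (latticeLine x₀ v t₀) ((v.1 : ℝ), (v.2 : ℝ)) with hm
  by_cases hm0 : m = 0
  · rwa [hm0] at hd
  exfalso
  have side : ∀ {Ω : Set (ℝ × ℝ)}, IsNodalDomain f Ω → latticeLine x₀ v t₀ ∈ closure Ω →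
      ((∀ t, latticeLine x₀ v t ∈ closure Ω → t₀ ≤ t) ∨
        ∀ t, latticeLine x₀ v t ∈ closure Ω → t ≤ t₀) → ∀ x ∈ Ω,
      ∀ t, latticeLine x₀ v t ∈ closure Ω → 0 ≤ m * f x * (t - t₀) := by
    intro Ω h hcl hext x hx t ht
    have hev := h.eventually_latticeLine_mem hf1 hd h0 (hreg _ h0) hcl hx
    rcases lt_or_gt_of_ne (mul_ne_zero hm0 (h.ne_zero hx)) with hs | hs
    · obtain ⟨s, hs1, hs2⟩ := ((frequently_lt_nhds t₀).and_eventually hev).exists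
      have hsΩ := subset_closure (hs2 (mul_pos_of_neg_of_neg hs (sub_neg.2 hs1)))
      rcases hext with he | he
      · exact absurd (he s hsΩ) (not_le.2 hs1)
      · exact mul_nonneg_of_nonpos_of_nonpos hs.le (sub_nonpos.2 (he t ht))
    · obtain ⟨s, hs1, hs2⟩ := ((frequently_gt_nhds t₀).and_eventually hev).exists
      have hsΩ := subset_closure (hs2 (_root_.mul_pos hs (sub_pos.2 hs1)))
      rcases hext with he | he
      · exact mul_nonneg hs.le (sub_nonneg.2 (he t ht))
      · exact absurd (he s hsΩ) (not_le.2 hs1)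
  obtain ⟨K, L, hK, hL⟩ := hper.exists_bounds_hamiltonianField hf
  set l : ℝ × ℝ →L[ℝ] ℝ := (-(v.2 : ℝ)) • ContinuousLinearMap.fst ℝ ℝ ℝ +
    (v.1 : ℝ) • ContinuousLinearMap.snd ℝ ℝ ℝ with hl
  have hlx : ∀ x, l x = -(v.2 : ℝ) * x.1 + v.1 * x.2 := fun x ↦ by simp [hl]
  have hlX : l (hamiltonianField f (latticeLine x₀ v t₀)) = -m := by
    rw [hlx, hamiltonianField, hm, map_eq_fst_snd (fderiv ℝ f _) ((v.1 : ℝ), (v.2 : ℝ))]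
    simp only
    ring
  obtain ⟨q, hqne, hq, hq', hlq⟩ := h.exists_ne_mem_closure hf1 hK hL hreg h' hb h0 hcl hcl' l
    (by rw [hlX]; exact neg_ne_zero.2 hm0)
  rw [hlx, hlx] at hlq
  obtain ⟨s, rfl⟩ := exists_eq_latticeLine hv hlq
  have s1 := side h hcl hext x hx s hq
  have s2 := side h' hcl' hext' y hy s hq'
  have hst : s ≠ t₀ := fun hst ↦ hqne (by rw [hst])
  have : 0 ≤ (m * (s - t₀)) ^ 2 * (f x * f y) := by
    calc 0 ≤ _ := mul_nonneg s1 s2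
      _ = _ := by ring
  have hpos : 0 < (m * (s - t₀)) ^ 2 := by
    have := sub_ne_zero.2 hst
    positivity
  exact absurd this (not_le.2 (mul_neg_of_pos_of_neg hpos hxy))

/-- On a line of integral direction, a trigonometric polynomial of degree `D` cuts at most `D`
bounded nodal domains. -/
theorem card_le_of_forall_meets_latticeLine (hf : ContDiff ℝ 2 f)
    (hper : IsLatticePeriodic f) (hreg : ∀ p, f p = 0 → fderiv ℝ f p ≠ 0) (hv : v ≠ 0)
    {D : ℕ} {Q : Polynomial ℂ} (hQ : IsTrigPolynomial (fun t ↦ f (latticeLine x₀ v t)) D Q)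
    (𝒟 : Finset (Set (ℝ × ℝ))) (hnod : ∀ Ω ∈ 𝒟, IsNodalDomain f Ω ∧ Bornology.IsBounded Ω)
    (hmeet : ∀ Ω ∈ 𝒟, ∃ t, latticeLine x₀ v t ∈ Ω)
    (hdisj : ∀ Ω ∈ 𝒟, ∀ Ω' ∈ 𝒟, ∀ x ∈ Ω, ∀ k : ℤ,
      x + (((k * v.1 : ℤ) : ℝ), ((k * v.2 : ℤ) : ℝ)) ∈ Ω' → k = 0) :
    𝒟.card ≤ D := by
  classical
  rcases 𝒟.eq_empty_or_nonempty with rfl | ⟨Ω₀, hΩ₀⟩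
  · simp
  have hf1 : ContDiff ℝ 1 f := hf.of_le one_le_two
  have hQ0 : Q ≠ 0 := by
    obtain ⟨t, ht⟩ := hmeet Ω₀ hΩ₀
    exact hQ.ne_zero ((hnod Ω₀ hΩ₀).1.ne_zero ht)
  have hend : ∀ Ω, ∃ e : Bool → ℝ, Ω ∈ 𝒟 → e false < e true ∧
      (∀ b, latticeLine x₀ v (e b) ∈ closure Ω ∧ f (latticeLine x₀ v (e b)) = 0) ∧
      ∀ t, latticeLine x₀ v t ∈ closure Ω → e false ≤ t ∧ t ≤ e true := by
    intro Ω
    by_cases hΩ : Ω ∈ 𝒟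
    · obtain ⟨t, ht⟩ := hmeet Ω hΩ
      obtain ⟨e, he⟩ := (hnod Ω hΩ).1.exists_endpoints hf.continuous (hnod Ω hΩ).2 hv ht
      exact ⟨e, fun _ ↦ he⟩
    · exact ⟨0, fun h ↦ absurd h hΩ⟩
  choose e he using hend
  choose! z hz using fun Ω (hΩ : Ω ∈ 𝒟) ↦ (hnod Ω hΩ).1.nonempty
  have hext : ∀ Ω ∈ 𝒟, ∀ b, (∀ t, latticeLine x₀ v t ∈ closure Ω → e Ω b ≤ t) ∨
      ∀ t, latticeLine x₀ v t ∈ closure Ω → t ≤ e Ω b := by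
    rintro Ω hΩ (_ | _)
    · exact .inl fun t ht ↦ ((he Ω hΩ).2.2 t ht).1
    · exact .inr fun t ht ↦ ((he Ω hΩ).2.2 t ht).2
  set S := 𝒟 ×ˢ (Finset.univ : Finset Bool) with hS
  set F : Set (ℝ × ℝ) × Bool → ℂ := fun x ↦ charZ 1 (e x.1 x.2)
  have hmaps : MapsTo F S Q.roots.toFinset := by
    rintro ⟨Ω, b⟩ h
    have hΩ : Ω ∈ 𝒟 := (Finset.mem_product.1 h).1
    rw [Finset.mem_coe, Multiset.mem_toFinset, Polynomial.mem_roots hQ0]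
    exact hQ.isRoot (((he Ω hΩ).2.1 b).2)
  have htr : ∀ Ω ∈ 𝒟, ∀ Ω' ∈ 𝒟, ∀ b b', F (Ω, b) = F (Ω', b') → (Ω, b) ≠ (Ω', b') →
      f (z Ω) * f (z Ω') < 0 ∧
      HasDerivAt (fun t ↦ f (latticeLine x₀ v t)) 0 (e Ω b) := by
    intro Ω hΩ Ω' hΩ' b b' hF hne
    obtain ⟨k, hk⟩ := charZ_one_eq_iff.1 hF
    simp only at hk
    set u : ℝ × ℝ := (((k * v.1 : ℤ) : ℝ), ((k * v.2 : ℤ) : ℝ)) with hu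
    have hfu : ∀ x, f (x + u) = f x := fun x ↦ hper x (k * v.1, k * v.2)
    have hnod' := (hnod Ω' hΩ').1.translate hfu
    have hclos : ∀ s, latticeLine x₀ v s ∈ closure Ω' ↔
        latticeLine x₀ v (s + k) ∈ closure ((fun x ↦ x + u) '' Ω') := by
      intro s
      have := (Homeomorph.addRight u).image_closure Ω'
      simp only [Homeomorph.coe_addRight] at this
      rw [← this, latticeLine_add_int]
      exact ((add_left_injective u).mem_set_image).symm
    have hcl' : latticeLine x₀ v (e Ω b) ∈ closure ((fun x ↦ x + u) '' Ω') := by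
      rw [hk, ← hclos]
      exact ((he Ω' hΩ').2.1 b').1
    have h0 := ((he Ω hΩ).2.1 b).2
    have hcl := ((he Ω hΩ).2.1 b).1
    have hsign : f (z Ω) * f (z Ω') < 0 := by
      by_contra! hnn
      have hpos : 0 < f (z Ω) * f (z Ω' + u) := by
        rw [hfu]
        exact lt_of_le_of_ne hnn (mul_ne_zero ((hnod Ω hΩ).1.ne_zero (hz Ω hΩ))
          ((hnod Ω' hΩ').1.ne_zero (hz Ω' hΩ'))).symm
      have heq := (hnod Ω hΩ).1.eq_of_mem_closure hf1 hnod' (hreg _ h0) hcl hcl' (hz Ω hΩ)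
        (mem_image_of_mem _ (hz Ω' hΩ')) hpos
      have hk0 : k = 0 := hdisj Ω' hΩ' Ω hΩ (z Ω') (hz Ω' hΩ') k
        (heq ▸ mem_image_of_mem _ (hz Ω' hΩ'))
      have hu0 : u = 0 := by simp [hu, hk0]
      have hΩΩ : Ω = Ω' := by simpa [hu0] using heq
      subst hΩΩ
      have hbb : e Ω b = e Ω b' := by simpa [hk0] using hk
      have := (he Ω hΩ).1
      apply hne
      rcases b with _ | _ <;> rcases b' with _ | _
      · rfl
      · exact absurd hbb this.ne
      · exact absurd hbb this.ne'
      · rfl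
    refine ⟨hsign, (hnod Ω hΩ).1.hasDerivAt_zero_of_extremal hf hper hreg hv hnod' (hnod Ω hΩ).2
      h0 hcl hcl' (hext Ω hΩ b) ?_ (hz Ω hΩ) (mem_image_of_mem _ (hz Ω' hΩ')) (by
        simpa only [hfu] using hsign)⟩
    have hsub : ∀ t, latticeLine x₀ v t ∈ closure ((fun x ↦ x + u) '' Ω') →
        latticeLine x₀ v (t - k) ∈ closure Ω' := fun t ht ↦ by
      rw [hclos, sub_add_cancel]
      exact ht
    rw [hk]
    rcases hext Ω' hΩ' b' with h | h
    · exact .inl fun t ht ↦ by linarith [h _ (hsub t ht)]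
    · exact .inr fun t ht ↦ by linarith [h _ (hsub t ht)]
  have hfib : ∀ w ∈ Q.roots.toFinset, (S.filter fun x ↦ F x = w).card ≤ Q.roots.count w := by
    intro w hw
    rw [Multiset.mem_toFinset] at hw
    by_cases hone : (S.filter fun x ↦ F x = w).card ≤ 1
    · exact hone.trans (Multiset.one_le_count_iff_mem.2 hw)
    push Not at hone
    obtain ⟨⟨Ω, b⟩, h1, ⟨Ω', b'⟩, h2, hne⟩ := Finset.one_lt_card.1 hone
    rw [Finset.mem_filter, hS, Finset.mem_product] at h1 h2
    have := (htr Ω h1.1.1 Ω' h2.1.1 b b' (h1.2.trans h2.2.symm) hne).2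
    have h3 := hQ.one_lt_rootMultiplicity hQ0 ((he Ω h1.1.1).2.1 b).2 this
    rw [Polynomial.count_roots]
    have h4 : charZ 1 (e Ω b) = w := h1.2
    rw [h4] at h3
    refine le_trans ?_ h3
    have hcard := Finset.card_le_card_of_injOn (s := S.filter fun x ↦ F x = w)
      (t := (Finset.univ : Finset Bool)) (fun x ↦ decide (0 < f (z x.1)))
      (fun _ _ ↦ Finset.mem_coe.2 (Finset.mem_univ _)) (by
        rintro ⟨Ω, b⟩ h1 ⟨Ω', b'⟩ h2 hdec
        by_contra hne
        simp only [Finset.coe_filter, hS, Finset.mem_product] at h1 h2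
        have := (htr Ω h1.1.1 Ω' h2.1.1 b b' (h1.2.trans h2.2.symm) hne).1
        simp only [decide_eq_decide] at hdec
        rcases mul_neg_iff.1 this with h | h
        · exact absurd (hdec.1 h.1) (not_lt.2 h.2.le)
        · exact absurd (hdec.2 h.2) (not_lt.2 h.1.le))
    simpa using hcard
  have htotal : S.card ≤ 2 * D := by
    rw [Finset.card_eq_sum_card_fiberwise hmaps]
    calc _ ≤ ∑ w ∈ Q.roots.toFinset, Q.roots.count w := Finset.sum_le_sum hfib
      _ = Q.roots.card := Multiset.toFinset_sum_count_eq _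
      _ ≤ Q.natDegree := Q.card_roots'
      _ ≤ 2 * D := hQ.1
  rw [hS, Finset.card_product] at htotal
  simp only [Finset.card_univ, Fintype.card_bool] at htotal
  omega

end LineCount

section Averaging

open Set MeasureTheory
open scoped ENNReal

theorem sum_volume_le_of_card_le {ι : Type*} (B : Finset ι) (I : ι → Set ℝ)
    (hI : ∀ i ∈ B, MeasurableSet (I i)) (D : ℕ)
    (h : ∀ (s : ℝ) (J : Finset ℤ),
      (@Finset.filter (ι × ℤ) (fun x ↦ s + x.2 ∈ I x.1) (Classical.decPred _) (B ×ˢ J)).card ≤ D) :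
    ∑ i ∈ B, volume (I i) ≤ D := by
  classical
  have key : ∀ i ∈ B, volume (I i) =
      ∑' k : ℤ, ∫⁻ s in Ioc (0 : ℝ) 1, (I i).indicator 1 (s + k) := by
    intro i hi
    rw [← lintegral_indicator_one (hI i hi), ← setLIntegral_univ, ← iUnion_Ioc_add_intCast (0 : ℝ),
      lintegral_iUnion (fun _ ↦ measurableSet_Ioc) (pairwise_disjoint_Ioc_add_intCast 0)]
    refine tsum_congr fun k ↦ ?_
    have := (measurePreserving_add_right volume (k : ℝ)).setLIntegral_comp_preimage
      (s := Ioc (0 + (k : ℝ)) (0 + k + 1)) measurableSet_Ioc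
      ((measurable_one.indicator (hI i hi)) : Measurable ((I i).indicator (1 : ℝ → ℝ≥0∞)))
    rw [← this]
    congr 2
    ext s
    simp only [mem_preimage, mem_Ioc]
    constructor <;> rintro ⟨h1, h2⟩ <;> constructor <;> linarith
  have hm : ∀ i ∈ B, ∀ k : ℤ, Measurable fun s : ℝ ↦ (I i).indicator (1 : ℝ → ℝ≥0∞) (s + k) :=
    fun i hi k ↦ (measurable_one.indicator (hI i hi)).comp (measurable_add_const _)
  calc ∑ i ∈ B, volume (I i)
      = ∑ i ∈ B, ∫⁻ s in Ioc (0 : ℝ) 1, ∑' k : ℤ, (I i).indicator 1 (s + k) :=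
        Finset.sum_congr rfl fun i hi ↦ by
          rw [key i hi, lintegral_tsum fun k ↦ (hm i hi k).aemeasurable]
    _ = ∫⁻ s in Ioc (0 : ℝ) 1, ∑ i ∈ B, ∑' k : ℤ, (I i).indicator 1 (s + k) := by
        rw [lintegral_finsetSum' _ fun i hi ↦
          (Measurable.tsum fun k ↦ hm i hi k).aemeasurable]
    _ ≤ ∫⁻ s in Ioc (0 : ℝ) 1, D := by
        refine lintegral_mono fun s ↦ ?_
        simp only
        rw [← Summable.tsum_finsetSum fun i _ ↦ ENNReal.summable, ENNReal.tsum_eq_iSup_sum]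
        refine iSup_le fun J ↦ ?_
        rw [Finset.sum_comm, ← Finset.sum_product']
        refine le_trans (le_of_eq ?_) (Nat.cast_le.2 (h s J))
        rw [Finset.card_filter]
        push_cast
        refine Finset.sum_congr rfl fun x _ ↦ ?_
        simp only [indicator_apply, Pi.one_apply]
    _ = D := by simp

theorem int_eq_zero_of_mem_Ioo {x : ℝ} {k : ℤ} (hx : x ∈ Ioo (0 : ℝ) 1)
    (hxk : x + k ∈ Ioo (0 : ℝ) 1) : k = 0 := by
  have h1 : (k : ℝ) < 1 := by linarith [hx.1, hxk.2]
  have h2 : (-1 : ℝ) < k := by linarith [hx.2, hxk.1]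
  have h3 : k < 1 := by exact_mod_cast h1
  have h4 : -1 < k := by exact_mod_cast h2
  omega

variable {ψ : ℝ × ℝ → ℝ} {n : ℕ}

theorem IsNodalDomain.width_ge {Ω : Set (ℝ × ℝ)}
    (hψ : ContDiff ℝ 2 ψ) (hn : 0 < n) (hlap : ∀ p, laplacian2 ψ p = -(4 * π ^ 2 * n) * ψ p)
    (h : IsNodalDomain ψ Ω) (hb : Bornology.IsBounded Ω) {a b : ℝ} (hab : a ≠ 0 ∨ b ≠ 0) :
    MeasurableSet ((fun x : ℝ × ℝ ↦ a * x.1 + b * x.2) '' Ω) ∧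
    ENNReal.ofReal (√(a ^ 2 + b ^ 2) / (2 * √n)) ≤
      volume ((fun x : ℝ × ℝ ↦ a * x.1 + b * x.2) '' Ω) := by
  set I := (fun x : ℝ × ℝ ↦ a * x.1 + b * x.2) '' Ω with hI
  have hpre : IsPreconnected I := h.isPreconnected.image _ (by fun_prop)
  refine ⟨hpre.ordConnected.measurableSet, ?_⟩
  obtain ⟨R, hR⟩ := hb.exists_norm_le
  have hbd : ∀ t ∈ I, |t| ≤ |a| * R + |b| * R := by
    rintro _ ⟨x, hx, rfl⟩
    have h1 := (norm_fst_le x).trans (hR x hx)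
    have h2 := (norm_snd_le x).trans (hR x hx)
    rw [Real.norm_eq_abs] at h1 h2
    refine (abs_add_le _ _).trans ?_
    rw [abs_mul, abs_mul]
    gcongr
  have hbelow : BddBelow I := ⟨-(|a| * R + |b| * R), fun t ht ↦ (abs_le.1 (hbd t ht)).1⟩
  have habove : BddAbove I := ⟨|a| * R + |b| * R, fun t ht ↦ (abs_le.1 (hbd t ht)).2⟩
  refine le_trans ?_ (measure_mono ((show IsConnected I from
    ⟨h.nonempty.image _, hpre⟩).Ioo_csInf_csSup_subset hbelow habove))
  rw [Real.volume_Ioo]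
  apply ENNReal.ofReal_le_ofReal
  by_contra! hlt
  set w := sSup I - sInf I with hw
  have hstrip : ∀ x ∈ Ω, sInf I ≤ a * x.1 + b * x.2 ∧ a * x.1 + b * x.2 ≤ sSup I := fun x hx ↦
    ⟨csInf_le hbelow (mem_image_of_mem _ hx), le_csSup habove (mem_image_of_mem _ hx)⟩
  have hw0 : 0 ≤ w := by
    obtain ⟨x, hx⟩ := h.nonempty
    linarith [(hstrip x hx).1, (hstrip x hx).2]
  have hsq : 0 < a ^ 2 + b ^ 2 := by
    rcases hab with h | h <;> positivity
  set r := √(a ^ 2 + b ^ 2) with hr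
  have hr0 : 0 < r := Real.sqrt_pos.2 hsq
  have hrr : r ^ 2 = a ^ 2 + b ^ 2 := Real.sq_sqrt hsq.le
  have hn0 : 0 < √(n : ℝ) := Real.sqrt_pos.2 (by exact_mod_cast hn)
  have hnn : √(n : ℝ) ^ 2 = n := Real.sq_sqrt (Nat.cast_nonneg n)
  set μ₀ := 2 * π * √n / r with hμ₀
  have hμ₀pos : 0 < μ₀ := by positivity
  have hμw : μ₀ * w < π := by
    calc μ₀ * w < μ₀ * (r / (2 * √n)) := by gcongr
      _ = π := by rw [hμ₀]; field_simp
  set δ := (π - μ₀ * w) / (2 * (w + 1)) with hδ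
  have hδ0 : 0 < δ := div_pos (by linarith) (by linarith)
  have hδw : δ * (2 * (w + 1)) = π - μ₀ * w := div_mul_cancel₀ _ (by linarith : 2 * (w + 1) ≠ 0)
  have hfin := h.mul_le_of_subset_strip hψ hb hlap hstrip (μ := μ₀ + δ) (by positivity) (by
    rw [← hw]; nlinarith)
  rw [← hrr] at hfin
  have : μ₀ ^ 2 * r ^ 2 = 4 * π ^ 2 * n := by
    rw [hμ₀, div_pow, div_mul_cancel₀ _ (by positivity), mul_pow, hnn]
    ring
  have h2 : μ₀ ^ 2 * r ^ 2 < (μ₀ + δ) ^ 2 * r ^ 2 := by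
    gcongr
    linarith
  linarith

/-- The number of nodal domains contained in the open unit square, bounded by averaging over
parallel lines of direction `(p, q)`. -/
theorem card_mul_le_of_subset_unitSquare (hψ : ContDiff ℝ 2 ψ) (hper : IsLatticePeriodic ψ)
    (hn : 0 < n) (hlap : ∀ p, laplacian2 ψ p = -(4 * π ^ 2 * n) * ψ p)
    (hreg : ∀ p, ψ p = 0 → fderiv ℝ ψ p ≠ 0) {p q : ℤ} (hpq : IsCoprime p q) {D : ℕ}
    (hD : ∀ ξ ∈ latticeCircle n, |ξ.1 * p + ξ.2 * q| ≤ D) (𝓑 : Finset (Set (ℝ × ℝ)))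
    (hnod : ∀ Ω ∈ 𝓑, IsNodalDomain ψ Ω)
    (hsub : ∀ Ω ∈ 𝓑, Ω ⊆ Ioo (0 : ℝ) 1 ×ˢ Ioo (0 : ℝ) 1) :
    𝓑.card * (√((p : ℝ) ^ 2 + (q : ℝ) ^ 2) / (2 * √n)) ≤ D := by
  classical
  have hv : ((p, q) : ℤ × ℤ) ≠ 0 := by
    intro h
    obtain ⟨rfl, rfl⟩ := Prod.mk.inj h
    exact not_isCoprime_zero_zero hpq
  have hbdd : ∀ Ω ∈ 𝓑, Bornology.IsBounded Ω := fun Ω hΩ ↦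
    ((Metric.isBounded_Ioo (0 : ℝ) 1).prod (Metric.isBounded_Ioo (0 : ℝ) 1)).subset (hsub Ω hΩ)
  have hab : (-(q : ℝ)) ≠ 0 ∨ (p : ℝ) ≠ 0 := by
    by_contra! h
    exact hv (Prod.ext (by exact_mod_cast h.2) (by exact_mod_cast neg_eq_zero.1 h.1))
  set I : Set (ℝ × ℝ) → Set ℝ := fun Ω ↦ (fun x : ℝ × ℝ ↦ -(q : ℝ) * x.1 + p * x.2) '' Ω with hI
  have hwidth := fun Ω hΩ ↦ (hnod Ω hΩ).width_ge hψ hn hlap (hbdd Ω hΩ) hab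
  obtain ⟨a, b, hcop⟩ := hpq
  have hcopR : (a : ℝ) * p + b * q = 1 := by exact_mod_cast hcop
  have hcount : ∑ Ω ∈ 𝓑, volume (I Ω) ≤ D := by
    refine sum_volume_le_of_card_le 𝓑 I (fun Ω hΩ ↦ (hwidth Ω hΩ).1) D fun s J ↦ ?_
    set A := @Finset.filter (Set (ℝ × ℝ) × ℤ) (fun x ↦ s + x.2 ∈ I x.1) (Classical.decPred _)
      (𝓑 ×ˢ J) with hA
    have hA1 : ∀ x ∈ A, x.1 ∈ 𝓑 := fun x hx ↦ (Finset.mem_product.1 (Finset.mem_filter.1 hx).1).1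
    have hA2 : ∀ x ∈ A, s + x.2 ∈ I x.1 := fun x hx ↦ (Finset.mem_filter.1 hx).2
    set u : ℤ → ℝ × ℝ := fun i ↦ (((i * b : ℤ) : ℝ), ((-i * a : ℤ) : ℝ)) with hu
    set τ : Set (ℝ × ℝ) × ℤ → Set (ℝ × ℝ) := fun x ↦ (fun y ↦ y + u x.2) '' x.1 with hτ
    have hmain : ∀ x ∈ A, ∀ x' ∈ A, ∀ y ∈ x.1, ∀ y' ∈ x'.1, ∀ k : ℤ,
        y + u x.2 + (((k * p : ℤ) : ℝ), ((k * q : ℤ) : ℝ)) = y' + u x'.2 → x.2 = x'.2 ∧ k = 0 := by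
      intro x hx x' hx' y hy y' hy' k hyy
      have hys := hsub _ (hA1 x hx) hy
      have hys' := hsub _ (hA1 x' hx') hy'
      rw [Prod.ext_iff] at hyy
      simp only [hu, Prod.fst_add, Prod.snd_add] at hyy
      have e1 : y'.1 = y.1 + ((x.2 * b - x'.2 * b + k * p : ℤ) : ℝ) := by
        push_cast at hyy ⊢; linarith [hyy.1]
      have e2 : y'.2 = y.2 + ((-x.2 * a + x'.2 * a + k * q : ℤ) : ℝ) := by
        push_cast at hyy ⊢; linarith [hyy.2]
      have z1 := int_eq_zero_of_mem_Ioo hys.1 (e1 ▸ hys'.1)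
      have z2 := int_eq_zero_of_mem_Ioo hys.2 (e2 ▸ hys'.2)
      have z3 : x.2 = x'.2 := by linear_combination q * z1 - p * z2 - (x.2 - x'.2) * hcop
      rw [z3] at z1 z2
      refine ⟨z3, ?_⟩
      linear_combination a * z1 + b * z2 - k * hcop
    have hinj : InjOn τ A := by
      intro x hx x' hx' hxx
      obtain ⟨y, hy⟩ := (hnod _ (hA1 x hx)).nonempty
      obtain ⟨y', hy', hyy⟩ : y + u x.2 ∈ τ x' := hxx ▸ mem_image_of_mem _ hy
      have h2 := (hmain x hx x' hx' y hy y' hy' 0 (by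
        simpa [← Prod.zero_eq_mk] using hyy.symm)).1
      rw [h2] at hyy
      have h3 : y' = y := add_right_cancel hyy
      exact Prod.ext ((hnod _ (hA1 x hx)).eq_of_mem (hnod _ (hA1 x' hx')) hy (h3 ▸ hy')) h2
    rw [← Finset.card_image_of_injOn hinj]
    obtain ⟨Q, hQ⟩ := exists_isTrigPolynomial hψ hper hlap (-s * b, s * a) (p, q) hD
    refine card_le_of_forall_meets_latticeLine (x₀ := (-s * b, s * a)) (v := (p, q)) hψ hper hreg
      hv hQ _ ?_ ?_ ?_
    · rintro _ hΩ
      obtain ⟨x, hx, rfl⟩ := Finset.mem_image.1 hΩ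
      refine ⟨(hnod _ (hA1 x hx)).translate fun y ↦ hper y (x.2 * b, -x.2 * a), ?_⟩
      exact (isometry_add_right (u x.2)).lipschitz.isBounded_image (hbdd _ (hA1 x hx))
    · rintro _ hΩ
      obtain ⟨x, hx, rfl⟩ := Finset.mem_image.1 hΩ
      obtain ⟨y, hy, hys⟩ := hA2 x hx
      simp only at hys
      obtain ⟨t, ht⟩ := exists_eq_latticeLine (x₀ := (-s * b, s * a)) hv
        (x := y + u x.2) (t := 0) (by
        simp only [latticeLine, hu, Prod.fst_add, Prod.snd_add]
        push_cast
        linear_combination hys + (-s - x.2) * hcopR)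
      exact ⟨t, ht ▸ mem_image_of_mem _ hy⟩
    · rintro _ hΩ _ hΩ' _ hyx k hk
      obtain ⟨x, hx, rfl⟩ := Finset.mem_image.1 hΩ
      obtain ⟨x', hx', rfl⟩ := Finset.mem_image.1 hΩ'
      obtain ⟨y, hy, rfl⟩ := hyx
      obtain ⟨y', hy', hyy⟩ := hk
      exact (hmain x hx x' hx' y hy y' hy' k hyy.symm).2
  have hsum : ∑ Ω ∈ 𝓑, ENNReal.ofReal (√((p : ℝ) ^ 2 + (q : ℝ) ^ 2) / (2 * √n)) ≤ D := by
    refine (Finset.sum_le_sum fun Ω hΩ ↦ ?_).trans hcount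
    have := (hwidth Ω hΩ).2
    rwa [neg_sq, add_comm] at this
  rw [Finset.sum_const, nsmul_eq_mul, ← ENNReal.ofReal_natCast, ← ENNReal.ofReal_natCast,
    ← ENNReal.ofReal_mul (Nat.cast_nonneg _)] at hsum
  exact (ENNReal.ofReal_le_ofReal_iff (Nat.cast_nonneg _)).1 hsum

end Averaging

section Direction

open Set

theorem inner_le_of_notMem_openSector {α θ r : ℝ} (hθ : 0 < θ) (hr : 0 < r) {x : ℝ × ℝ}
    (hx : x.1 ^ 2 + x.2 ^ 2 = r ^ 2) (hsec : x ∉ openSector α (2 * θ)) :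
    θ ≤ π ∧ x.1 * cos (α + θ) + x.2 * sin (α + θ) ≤ r * cos θ := by
  set β := α + θ with hβ
  set w : ℂ := ⟨x.1 * cos β + x.2 * sin β, x.2 * cos β - x.1 * sin β⟩ with hw
  have hnorm : ‖w‖ = r := by
    rw [← Real.sqrt_sq hr.le, Complex.norm_def, Complex.normSq_mk, ← hx]
    congr 1
    linear_combination (x.1 ^ 2 + x.2 ^ 2) * Real.sin_sq_add_cos_sq β
  set δ := w.arg with hδ
  have hre : r * cos δ = x.1 * cos β + x.2 * sin β := by
    rw [← hnorm, hδ, Complex.norm_mul_cos_arg]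
  have him : r * sin δ = x.2 * cos β - x.1 * sin β := by
    rw [← hnorm, hδ, Complex.norm_mul_sin_arg]
  have hnot : ¬ |δ| < θ := by
    intro hlt
    obtain ⟨h1, h2⟩ := abs_lt.1 hlt
    refine hsec ⟨r, δ + β, hr, by linarith, by linarith, ?_⟩
    have hsc := Real.sin_sq_add_cos_sq β
    ext
    · simp only [Real.cos_add]
      linear_combination -cos β * hre + sin β * him - x.1 * hsc
    · simp only [Real.sin_add]
      linear_combination -cos β * him - sin β * hre - x.2 * hsc
  push Not at hnot
  have hδπ : |δ| ≤ π := Complex.abs_arg_le_pi w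
  refine ⟨hnot.trans hδπ, ?_⟩
  rw [← hre, ← Real.cos_abs δ]
  exact mul_le_mul_of_nonneg_left
    (Real.strictAntiOn_cos.antitoneOn ⟨hθ.le, hnot.trans hδπ⟩ ⟨abs_nonneg _, hδπ⟩ hnot) hr.le

theorem exists_isCoprime_mem {U : Set (ℝ × ℝ)} (hU : IsOpen U) (hne : U.Nonempty) (h0 : 0 ∉ U)
    (hscale : ∀ x ∈ U, ∀ r : ℝ, 0 < r → r • x ∈ U) :
    ∃ p q : ℤ, IsCoprime p q ∧ ((p : ℝ), (q : ℝ)) ∈ U := by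
  obtain ⟨⟨a, b⟩, hab⟩ := ((Rat.denseRange_cast (𝕜 := ℝ)).prodMap
    (Rat.denseRange_cast (𝕜 := ℝ))).exists_mem_open hU hne
  simp only [Prod.map_apply] at hab
  have hden : (0 : ℝ) < a.den * b.den := by
    have := a.den_pos
    have := b.den_pos
    positivity
  have h1 := hscale _ hab _ hden
  have e1 : ((a.den * b.den : ℝ)) • ((a : ℝ), (b : ℝ)) =
      (((a.num * b.den : ℤ) : ℝ), ((b.num * a.den : ℤ) : ℝ)) := by
    have ha : (a : ℝ) * a.den = a.num := by exact_mod_cast Rat.mul_den_eq_num a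
    have hb : (b : ℝ) * b.den = b.num := by exact_mod_cast Rat.mul_den_eq_num b
    ext <;> simp only [Prod.smul_mk, smul_eq_mul] <;> push_cast
    · rw [← ha]; ring
    · rw [← hb]; ring
  rw [e1] at h1
  set P := a.num * b.den
  set R := b.num * a.den
  have hg : 0 < Int.gcd P R := by
    refine Nat.pos_of_ne_zero fun h ↦ h0 ?_
    obtain ⟨hP, hR⟩ := Int.gcd_eq_zero_iff.1 h
    rw [hP, hR, Int.cast_zero] at h1
    exact h1
  obtain ⟨p, q, hpq, hp, hq⟩ := Int.exists_gcd_one hg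
  refine ⟨p, q, Int.isCoprime_iff_gcd_eq_one.2 hpq, ?_⟩
  have hg' : (0 : ℝ) < Int.gcd P R := by exact_mod_cast hg
  have h2 := hscale _ h1 _ (inv_pos.2 hg')
  have hpR : (P : ℝ) = p * Int.gcd P R := by exact_mod_cast hp
  have hqR : (R : ℝ) = q * Int.gcd P R := by exact_mod_cast hq
  convert h2 using 1
  ext <;> simp only [Prod.smul_mk, smul_eq_mul]
  · rw [hpR]; field_simp
  · rw [hqR]; field_simp

theorem exists_isCoprime_forall_latticeCircle {θ ε : ℝ} (hε : 0 < ε) (hθε : ε < θ) {n : ℕ}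
    (hn : 0 < n) (hS : (latticeCircle n).Nonempty) {α : ℝ}
    (hsec : ∀ a b : ℤ, a ^ 2 + b ^ 2 = (n : ℤ) → ((a : ℝ), (b : ℝ)) ∉ openSector α (2 * θ)) :
    ∃ p q : ℤ, IsCoprime p q ∧ ∀ ξ ∈ latticeCircle n, |(ξ.1 : ℝ) * p + ξ.2 * q| <
      √n * √((p : ℝ) ^ 2 + (q : ℝ) ^ 2) * cos (θ - ε) := by
  have hθ : 0 < θ := hε.trans hθε
  have hn0 : 0 < √(n : ℝ) := Real.sqrt_pos.2 (by exact_mod_cast hn)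
  have hnn : √(n : ℝ) ^ 2 = n := Real.sq_sqrt (Nat.cast_nonneg n)
  have key : ∀ a b : ℤ, a ^ 2 + b ^ 2 = (n : ℤ) →
      θ ≤ π ∧ (a : ℝ) * cos (α + θ) + b * sin (α + θ) ≤ √n * cos θ := fun a b h ↦
    inner_le_of_notMem_openSector hθ hn0 (by
      rw [hnn]
      change (a : ℝ) ^ 2 + (b : ℝ) ^ 2 = n
      exact_mod_cast h) (hsec a b h)
  obtain ⟨ξ₀, hξ₀⟩ := hS
  have hθπ := (key ξ₀.1 ξ₀.2 (mem_latticeCircle.1 hξ₀)).1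
  have hcos : cos θ < cos (θ - ε) :=
    Real.cos_lt_cos_of_nonneg_of_le_pi (by linarith) hθπ (by linarith)
  set U : Set (ℝ × ℝ) := {x | ∀ ξ ∈ latticeCircle n, |(ξ.1 : ℝ) * x.1 + ξ.2 * x.2| <
      √n * √(x.1 ^ 2 + x.2 ^ 2) * cos (θ - ε)} with hU
  have hopen : IsOpen U := by
    have : U = ⋂ ξ ∈ latticeCircle n, {x : ℝ × ℝ | |(ξ.1 : ℝ) * x.1 + ξ.2 * x.2| <
      √n * √(x.1 ^ 2 + x.2 ^ 2) * cos (θ - ε)} := by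
      ext x
      simp only [mem_iInter]
      rfl
    rw [this]
    exact isOpen_biInter_finset fun ξ _ ↦ isOpen_lt (by fun_prop) (by fun_prop)
  have hmem : (cos (α + θ), sin (α + θ)) ∈ U := by
    intro ξ hξ
    have h1 := (key ξ.1 ξ.2 (mem_latticeCircle.1 hξ)).2
    have h2 := (key (-ξ.1) (-ξ.2) (by rw [neg_sq, neg_sq]; exact mem_latticeCircle.1 hξ)).2
    push_cast at h2
    simp only [Real.cos_sq_add_sin_sq, Real.sqrt_one, mul_one]
    have h3 : √(n : ℝ) * cos θ < √n * cos (θ - ε) := by gcongr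
    rw [abs_lt]
    constructor <;> linarith
  obtain ⟨p, q, hpq, hU'⟩ := exists_isCoprime_mem hopen ⟨_, hmem⟩ (fun h ↦ by
    have := h ξ₀ hξ₀
    simp at this) (fun x hx r hr ξ hξ ↦ by
    have := mul_lt_mul_of_pos_left (hx ξ hξ) hr
    simp only [Prod.smul_fst, Prod.smul_snd, smul_eq_mul]
    rw [show (ξ.1 : ℝ) * (r * x.1) + ξ.2 * (r * x.2) = r * (ξ.1 * x.1 + ξ.2 * x.2) by ring,
      abs_mul, abs_of_pos hr,
      show (r * x.1) ^ 2 + (r * x.2) ^ 2 = r ^ 2 * (x.1 ^ 2 + x.2 ^ 2) by ring,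
      Real.sqrt_mul (sq_nonneg r), Real.sqrt_sq hr.le]
    calc _ < _ := this
      _ = _ := by ring)
  exact ⟨p, q, hpq, hU'⟩

theorem latticeCircle_nonempty {ψ : ℝ × ℝ → ℝ} (hψ : ContDiff ℝ 2 ψ) (hper : IsLatticePeriodic ψ)
    {n : ℕ} (hlap : ∀ p, laplacian2 ψ p = -(4 * π ^ 2 * n) * ψ p) (hne : ∃ p, ψ p ≠ 0) :
    (latticeCircle n).Nonempty := by
  obtain ⟨c, hc⟩ := exists_eq_sum_charZ hψ hper hlap
  obtain ⟨p, hp⟩ := hne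
  by_contra! h
  have := hc p
  rw [h, Finset.sum_empty, Complex.ofReal_eq_zero] at this
  exact hp this

/-- The number of nodal domains inside the open unit square. -/
theorem card_le_two_mul_cos {θ ε : ℝ} (hε : 0 < ε) (hθε : ε < θ) {ψ : ℝ × ℝ → ℝ} {n : ℕ}
    (hψ : ContDiff ℝ 2 ψ) (hper : IsLatticePeriodic ψ)
    (hn : 0 < n) (hlap : ∀ p, laplacian2 ψ p = -(4 * π ^ 2 * n) * ψ p) (hne : ∃ p, ψ p ≠ 0)
    (hreg : ∀ p, ψ p = 0 → fderiv ℝ ψ p ≠ 0) {α : ℝ}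
    (hsec : ∀ a b : ℤ, a ^ 2 + b ^ 2 = (n : ℤ) → ((a : ℝ), (b : ℝ)) ∉ openSector α (2 * θ))
    (𝓑 : Finset (Set (ℝ × ℝ))) (hnod : ∀ Ω ∈ 𝓑, IsNodalDomain ψ Ω)
    (hsub : ∀ Ω ∈ 𝓑, Ω ⊆ Ioo (0 : ℝ) 1 ×ˢ Ioo (0 : ℝ) 1) :
    (𝓑.card : ℝ) ≤ 2 * n * cos (θ - ε) := by
  have hS := latticeCircle_nonempty hψ hper hlap hne
  obtain ⟨p, q, hpq, hdir⟩ := exists_isCoprime_forall_latticeCircle hε hθε hn hS hsec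
  obtain ⟨ξ₀, hξ₀⟩ := hS
  set B := √n * √((p : ℝ) ^ 2 + (q : ℝ) ^ 2) * cos (θ - ε) with hB
  have hB0 : 0 ≤ B := (abs_nonneg _).trans (hdir ξ₀ hξ₀).le
  have hD : ∀ ξ ∈ latticeCircle n, |ξ.1 * p + ξ.2 * q| ≤ (⌊B⌋₊ : ℤ) := by
    intro ξ hξ
    rw [Int.natCast_floor_eq_floor hB0, Int.le_floor]
    push_cast
    exact (hdir ξ hξ).le
  have h1 := card_mul_le_of_subset_unitSquare hψ hper hn hlap hreg hpq hD 𝓑 hnod hsub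
  have h2 := h1.trans (Nat.floor_le hB0)
  have hn0 : 0 < √(n : ℝ) := Real.sqrt_pos.2 (by exact_mod_cast hn)
  have hnn : √(n : ℝ) ^ 2 = n := Real.sq_sqrt (Nat.cast_nonneg n)
  have hr : 0 < √((p : ℝ) ^ 2 + (q : ℝ) ^ 2) := by
    refine lt_of_le_of_ne (Real.sqrt_nonneg _) fun h ↦ ?_
    have := hdir ξ₀ hξ₀
    rw [hB, ← h, mul_zero, zero_mul] at this
    exact absurd this (not_lt.2 (abs_nonneg _))
  set r := √((p : ℝ) ^ 2 + (q : ℝ) ^ 2)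
  rw [← hnn]
  have h3 : (𝓑.card : ℝ) * (r / (2 * √n)) * (2 * √n / r) = 𝓑.card := by field_simp
  have h4 : B * (2 * √n / r) = 2 * √(n : ℝ) ^ 2 * cos (θ - ε) := by rw [hB]; field_simp
  rw [← h3, ← h4]
  gcongr

end Direction

section Torus

open Set

theorem connectedComponentIn_eq_of_forall_Icc {X : Type*} [TopologicalSpace X] {S : Set X}
    {γ : ℝ → X} (hγ : Continuous γ) {t u : ℝ} (htu : t ≤ u) (hS : ∀ w ∈ Icc t u, γ w ∈ S) :
    connectedComponentIn S (γ t) = connectedComponentIn S (γ u) :=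
  connectedComponentIn_eq ((isPreconnected_Icc.image γ hγ.continuousOn).subset_connectedComponentIn
    (mem_image_of_mem γ (left_mem_Icc.2 htu)) (image_subset_iff.2 hS)
    (mem_image_of_mem γ (right_mem_Icc.2 htu)))

theorem exists_next_zero {g : ℝ → ℝ} (hg : Continuous g) (hper : ∀ t (k : ℤ), g (t + k) = g t)
    {z t : ℝ} (hz : g z = 0) (ht : g t ≠ 0) :
    ∃ s, t < s ∧ g s = 0 ∧ ∀ u, t ≤ u → u < s → g u ≠ 0 := by
  set A := Ici t ∩ g ⁻¹' {0} with hA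
  have hcl : IsClosed A := isClosed_Ici.inter (isClosed_singleton.preimage hg)
  have hne : A.Nonempty := by
    refine ⟨z + ⌈t - z⌉, ?_, ?_⟩
    · have := Int.le_ceil (t - z)
      simp only [mem_Ici]
      linarith
    · simp only [mem_preimage, mem_singleton_iff, hper, hz]
  have hbdd : BddBelow A := ⟨t, fun x hx ↦ hx.1⟩
  obtain ⟨h1, h2⟩ := hcl.csInf_mem hne hbdd
  refine ⟨sInf A, lt_of_le_of_ne h1 fun h ↦ ht (h ▸ h2), h2, fun u hu hus h0 ↦ ?_⟩
  exact not_lt.2 (csInf_le hbdd ⟨hu, h0⟩) hus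

/-- A closed curve along which the nonvanishing set of a trigonometric polynomial of degree `D`
is mapped into `S` meets at most `2 * D + 1` components of `S` there. -/
theorem IsTrigPolynomial.card_connectedComponentIn_le {X : Type*} [TopologicalSpace X]
    {S : Set X} {γ : ℝ → X} (hγ : Continuous γ) (hγper : ∀ t (k : ℤ), γ (t + k) = γ t)
    {g : ℝ → ℝ} (hg : Continuous g) (hgper : ∀ t (k : ℤ), g (t + k) = g t)
    (hS : ∀ t, g t ≠ 0 → γ t ∈ S) {D : ℕ} {Q : Polynomial ℂ} (hQ : IsTrigPolynomial g D Q)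
    (𝓒 : Finset (Set X))
    (h𝓒 : ∀ C ∈ 𝓒, ∃ t, g t ≠ 0 ∧ C = connectedComponentIn S (γ t)) :
    𝓒.card ≤ 2 * D + 1 := by
  by_cases hz : ∃ z, g z = 0
  · obtain ⟨z, hz⟩ := hz
    have key : ∀ C ∈ 𝓒, ∃ t s, C = connectedComponentIn S (γ t) ∧ t < s ∧ g s = 0 ∧
        g t ≠ 0 ∧ ∀ u, t ≤ u → u < s → g u ≠ 0 := by
      intro C hC
      obtain ⟨t, ht, rfl⟩ := h𝓒 C hC
      obtain ⟨s, hs⟩ := exists_next_zero hg hgper hz ht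
      exact ⟨t, s, rfl, hs.1, hs.2.1, ht, hs.2.2⟩
    choose! t s hC hts hs ht hu using key
    have hcard : 𝓒.card ≤ Q.roots.toFinset.card := by
      refine Finset.card_le_card_of_injOn (fun C ↦ charZ 1 (s C)) (fun C h ↦ ?_)
        fun C h C' h' hcc ↦ ?_
      · simpa only [Finset.mem_coe, Multiset.mem_toFinset] using
          (Polynomial.mem_roots (hQ.ne_zero (ht C h))).2 (hQ.isRoot (hs C h))
      · obtain ⟨k, hk⟩ := charZ_one_eq_iff.1 hcc
        set u := max (t C) (t C' + k) with hudef
        have h1 : t C ≤ u := le_max_left _ _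
        have h2 : t C' ≤ u - k := by
          have := le_max_right (t C) (t C' + k)
          linarith
        have h3 : u < s C := max_lt (hts C h) (by linarith [hts C' h'])
        rw [hC C h, hC C' h',
          connectedComponentIn_eq_of_forall_Icc hγ h1 fun w hw ↦
            hS w (hu C h w hw.1 (hw.2.trans_lt h3)),
          connectedComponentIn_eq_of_forall_Icc hγ h2 fun w hw ↦
            hS w (hu C' h' w hw.1 (hw.2.trans_lt (by linarith))),
          ← hγper (u - k) k, sub_add_cancel]
    calc 𝓒.card ≤ Q.roots.toFinset.card := hcard
      _ ≤ Q.roots.card := Multiset.toFinset_card_le _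
      _ ≤ Q.natDegree := Q.card_roots'
      _ ≤ 2 * D + 1 := hQ.1.trans (Nat.le_succ _)
  · push Not at hz
    refine (Finset.card_le_one.2 fun C h C' h' ↦ ?_).trans (by omega)
    obtain ⟨t, -, rfl⟩ := h𝓒 C h
    obtain ⟨t', -, rfl⟩ := h𝓒 C' h'
    rcases le_total t t' with h | h
    · exact connectedComponentIn_eq_of_forall_Icc hγ h fun w _ ↦ hS w (hz w)
    · exact (connectedComponentIn_eq_of_forall_Icc hγ h fun w _ ↦ hS w (hz w)).symm

theorem IsNodalDomain.subset_unitSquare {f : ℝ × ℝ → ℝ} {Ω : Set (ℝ × ℝ)}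
    (hΩ : IsNodalDomain f Ω) {x : ℝ × ℝ} (hx : x ∈ Ω) (hx1 : x.1 ∈ Ioo (0 : ℝ) 1)
    (hx2 : x.2 ∈ Ioo (0 : ℝ) 1) (h1 : ∀ p ∈ Ω, ∀ k : ℤ, p.1 ≠ k)
    (h2 : ∀ p ∈ Ω, ∀ k : ℤ, p.2 ≠ k) : Ω ⊆ Ioo (0 : ℝ) 1 ×ˢ Ioo (0 : ℝ) 1 := by
  have aux : ∀ {A : Set ℝ}, IsPreconnected A → ∀ {a b : ℝ}, a ∈ A → a ∈ Ioo (0 : ℝ) 1 →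
      (∀ c ∈ A, ∀ k : ℤ, c ≠ k) → b ∈ A → b ∈ Ioo (0 : ℝ) 1 := by
    intro A hA a b ha ha' hk hb
    have hoc := hA.ordConnected
    constructor <;> by_contra! h
    · exact hk 0 (hoc.out hb ha ⟨h, ha'.1.le⟩) 0 (by simp)
    · exact hk 1 (hoc.out ha hb ⟨ha'.2.le, h⟩) 1 (by simp)
  intro p hp
  refine ⟨aux (hΩ.isPreconnected.image _ continuous_fst.continuousOn) (mem_image_of_mem _ hx) hx1
      ?_ (mem_image_of_mem _ hp),
    aux (hΩ.isPreconnected.image _ continuous_snd.continuousOn) (mem_image_of_mem _ hx) hx2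
      ?_ (mem_image_of_mem _ hp)⟩
  · rintro _ ⟨q, hq, rfl⟩
    exact h1 q hq
  · rintro _ ⟨q, hq, rfl⟩
    exact h2 q hq

theorem abs_le_sqrt_of_mem_latticeCircle {n : ℕ} {ξ : ℤ × ℤ} (hξ : ξ ∈ latticeCircle n) :
    |ξ.1| ≤ Nat.sqrt n ∧ |ξ.2| ≤ Nat.sqrt n := by
  have h := mem_latticeCircle.1 hξ
  constructor <;> rw [Int.abs_eq_natAbs, Int.ofNat_le, Nat.le_sqrt, ← Int.ofNat_le] <;>
    push_cast <;> rw [abs_mul_abs_self] <;> nlinarith [sq_nonneg ξ.1, sq_nonneg ξ.2]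

/-- The projection of the plane onto the torus. -/
def torusMk (p : ℝ × ℝ) : Torus2 := (p.1, p.2)

theorem continuous_torusMk : Continuous torusMk :=
  ((AddCircle.continuous_mk' 1).comp continuous_fst).prodMk
    ((AddCircle.continuous_mk' 1).comp continuous_snd)

theorem addCircle_coe_add_intCast (t : ℝ) (k : ℤ) :
    ((t + k : ℝ) : AddCircle (1 : ℝ)) = (t : AddCircle (1 : ℝ)) := by
  have : ((k : ℝ) : AddCircle (1 : ℝ)) = 0 := (AddCircle.coe_eq_zero_iff 1).2 ⟨k, by simp⟩
  rw [AddCircle.coe_add, this, add_zero]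

theorem exists_torusMk_eq (z : Torus2) :
    ∃ p : ℝ × ℝ, p.1 ∈ Ico (0 : ℝ) 1 ∧ p.2 ∈ Ico (0 : ℝ) 1 ∧ torusMk p = z := by
  obtain ⟨⟨x, hx⟩, ⟨y, hy⟩⟩ := And.intro (QuotientAddGroup.mk_surjective z.1)
    (QuotientAddGroup.mk_surjective z.2)
  refine ⟨(Int.fract x, Int.fract y), ⟨Int.fract_nonneg _, Int.fract_lt_one _⟩,
    ⟨Int.fract_nonneg _, Int.fract_lt_one _⟩, Prod.ext ?_ ?_⟩
  · change ((Int.fract x : ℝ) : AddCircle (1 : ℝ)) = _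
    rw [← addCircle_coe_add_intCast _ ⌊x⌋, Int.fract_add_floor]
    exact hx
  · change ((Int.fract y : ℝ) : AddCircle (1 : ℝ)) = _
    rw [← addCircle_coe_add_intCast _ ⌊y⌋, Int.fract_add_floor]
    exact hy

variable {ψ : ℝ × ℝ → ℝ} {φ : Torus2 → ℝ}

theorem connectedComponentIn_torusMk_eq (hφ : ∀ p, φ (torusMk p) = ψ p) {Ω : Set (ℝ × ℝ)}
    (hΩ : IsNodalDomain ψ Ω) {p q : ℝ × ℝ} (hp : p ∈ Ω) (hq : q ∈ Ω) :
    connectedComponentIn {z | φ z ≠ 0} (torusMk p) =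
      connectedComponentIn {z | φ z ≠ 0} (torusMk q) := by
  refine connectedComponentIn_eq ((hΩ.isPreconnected.image _
    continuous_torusMk.continuousOn).subset_connectedComponentIn (mem_image_of_mem _ hp) ?_
    (mem_image_of_mem _ hq))
  rintro _ ⟨x, hx, rfl⟩
  change φ (torusMk x) ≠ 0
  rw [hφ]
  exact hΩ.ne_zero hx

theorem exists_isNodalDomain_subset_unitSquare (hφ : ∀ p, φ (torusMk p) = ψ p) {z : Torus2}
    (hz : φ z ≠ 0)
    (hv : ∀ t, ψ (0, t) ≠ 0 → connectedComponentIn {z | φ z ≠ 0} z ≠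
      connectedComponentIn {z | φ z ≠ 0} (torusMk (0, t)))
    (hh : ∀ t, ψ (t, 0) ≠ 0 → connectedComponentIn {z | φ z ≠ 0} z ≠
      connectedComponentIn {z | φ z ≠ 0} (torusMk (t, 0))) :
    ∃ Ω, IsNodalDomain ψ Ω ∧ Ω ⊆ Ioo (0 : ℝ) 1 ×ˢ Ioo (0 : ℝ) 1 ∧
      ∀ p ∈ Ω, connectedComponentIn {z | φ z ≠ 0} z =
        connectedComponentIn {z | φ z ≠ 0} (torusMk p) := by
  obtain ⟨x, hx1, hx2, rfl⟩ := exists_torusMk_eq z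
  rw [hφ] at hz
  set Ω := connectedComponentIn {p | ψ p ≠ 0} x with hΩdef
  have hΩ : IsNodalDomain ψ Ω := ⟨x, hz, rfl⟩
  have hxΩ : x ∈ Ω := mem_connectedComponentIn hz
  have hC : ∀ p ∈ Ω, connectedComponentIn {z | φ z ≠ 0} (torusMk x) =
      connectedComponentIn {z | φ z ≠ 0} (torusMk p) := fun p hp ↦
    connectedComponentIn_torusMk_eq hφ hΩ hxΩ hp
  have h1 : ∀ p ∈ Ω, ∀ k : ℤ, p.1 ≠ k := by
    intro p hp k hk
    have hpk : torusMk p = torusMk (0, p.2) := by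
      refine Prod.ext ?_ rfl
      change (p.1 : AddCircle (1 : ℝ)) = ((0 : ℝ) : AddCircle (1 : ℝ))
      rw [hk, ← addCircle_coe_add_intCast 0 k, zero_add]
    refine hv p.2 ?_ (hpk ▸ hC p hp)
    rw [← hφ, ← hpk, hφ]
    exact hΩ.ne_zero hp
  have h2 : ∀ p ∈ Ω, ∀ k : ℤ, p.2 ≠ k := by
    intro p hp k hk
    have hpk : torusMk p = torusMk (p.1, 0) := by
      refine Prod.ext rfl ?_
      change (p.2 : AddCircle (1 : ℝ)) = ((0 : ℝ) : AddCircle (1 : ℝ))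
      rw [hk, ← addCircle_coe_add_intCast 0 k, zero_add]
    refine hh p.1 ?_ (hpk ▸ hC p hp)
    rw [← hφ, ← hpk, hφ]
    exact hΩ.ne_zero hp
  refine ⟨Ω, hΩ, hΩ.subset_unitSquare hxΩ ⟨lt_of_le_of_ne hx1.1 fun h ↦ h1 x hxΩ 0 ?_, hx1.2⟩
    ⟨lt_of_le_of_ne hx2.1 fun h ↦ h2 x hxΩ 0 ?_, hx2.2⟩ h1 h2, hC⟩
  · rw [← h, Int.cast_zero]
  · rw [← h, Int.cast_zero]

theorem card_le_of_meets_fst_eq_zero {n : ℕ} (hψ : ContDiff ℝ 2 ψ) (hper : IsLatticePeriodic ψ)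
    (hlap : ∀ p, laplacian2 ψ p = -(4 * π ^ 2 * n) * ψ p) (hφ : ∀ p, φ (torusMk p) = ψ p)
    (𝓒 : Finset (Set Torus2)) (h𝓒 : ∀ C ∈ 𝓒, ∃ t, ψ (0, t) ≠ 0 ∧
      C = connectedComponentIn {z | φ z ≠ 0} (torusMk (0, t))) : 𝓒.card ≤ 2 * Nat.sqrt n + 1 := by
  obtain ⟨Q, hQ⟩ := exists_isTrigPolynomial hψ hper hlap (0, 0) (0, 1) (D := Nat.sqrt n)
    fun ξ hξ ↦ by simpa using (abs_le_sqrt_of_mem_latticeCircle hξ).2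
  simp only [Int.cast_zero, Int.cast_one, mul_zero, mul_one, zero_add] at hQ
  have hψ0 : Continuous ψ := hψ.continuous
  refine hQ.card_connectedComponentIn_le (S := {z | φ z ≠ 0}) (γ := fun t ↦ torusMk (0, t))
    (continuous_torusMk.comp (by fun_prop)) (fun t k ↦ ?_) (by fun_prop) (fun t k ↦ ?_)
    (fun t ht ↦ ?_) 𝓒 h𝓒
  · exact Prod.ext rfl (addCircle_coe_add_intCast t k)
  · simpa using hper (0, t) (0, k)
  · rwa [← hφ] at ht

theorem card_le_of_meets_snd_eq_zero {n : ℕ} (hψ : ContDiff ℝ 2 ψ) (hper : IsLatticePeriodic ψ)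
    (hlap : ∀ p, laplacian2 ψ p = -(4 * π ^ 2 * n) * ψ p) (hφ : ∀ p, φ (torusMk p) = ψ p)
    (𝓒 : Finset (Set Torus2)) (h𝓒 : ∀ C ∈ 𝓒, ∃ t, ψ (t, 0) ≠ 0 ∧
      C = connectedComponentIn {z | φ z ≠ 0} (torusMk (t, 0))) : 𝓒.card ≤ 2 * Nat.sqrt n + 1 := by
  obtain ⟨Q, hQ⟩ := exists_isTrigPolynomial hψ hper hlap (0, 0) (1, 0) (D := Nat.sqrt n)
    fun ξ hξ ↦ by simpa using (abs_le_sqrt_of_mem_latticeCircle hξ).1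
  simp only [Int.cast_zero, Int.cast_one, mul_zero, mul_one, zero_add] at hQ
  have hψ0 : Continuous ψ := hψ.continuous
  refine hQ.card_connectedComponentIn_le (S := {z | φ z ≠ 0}) (γ := fun t ↦ torusMk (t, 0))
    (continuous_torusMk.comp (by fun_prop)) (fun t k ↦ ?_) (by fun_prop) (fun t k ↦ ?_)
    (fun t ht ↦ ?_) 𝓒 h𝓒
  · exact Prod.ext (addCircle_coe_add_intCast t k) rfl
  · simpa using hper (t, 0) (k, 0)
  · rwa [← hφ] at ht

theorem card_components_torus_le {θ ε : ℝ} (hε : 0 < ε) (hθε : ε < θ) {n : ℕ}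
    (hψ : ContDiff ℝ 2 ψ) (hper : IsLatticePeriodic ψ)
    (hn : 0 < n) (hlap : ∀ p, laplacian2 ψ p = -(4 * π ^ 2 * n) * ψ p) (hne : ∃ p, ψ p ≠ 0)
    (hreg : ∀ p, ψ p = 0 → fderiv ℝ ψ p ≠ 0) {α : ℝ}
    (hsec : ∀ a b : ℤ, a ^ 2 + b ^ 2 = (n : ℤ) → ((a : ℝ), (b : ℝ)) ∉ openSector α (2 * θ))
    (hφ : ∀ p, φ (torusMk p) = ψ p) (𝓒 : Finset (Set Torus2))
    (h𝓒 : ∀ C ∈ 𝓒, ∃ z, φ z ≠ 0 ∧ connectedComponentIn {z | φ z ≠ 0} z = C) :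
    (𝓒.card : ℝ) ≤ 2 * n * cos (θ - ε) + 6 * √n := by
  classical
  set P : Set Torus2 → Prop := fun C ↦ ∃ t, ψ (0, t) ≠ 0 ∧
    C = connectedComponentIn {z | φ z ≠ 0} (torusMk (0, t)) with hP
  set R : Set Torus2 → Prop := fun C ↦ ∃ t, ψ (t, 0) ≠ 0 ∧
    C = connectedComponentIn {z | φ z ≠ 0} (torusMk (t, 0)) with hR
  have h1 := card_le_of_meets_fst_eq_zero hψ hper hlap hφ (𝓒.filter P)
    fun C hC ↦ (Finset.mem_filter.1 hC).2
  have h2 := card_le_of_meets_snd_eq_zero hψ hper hlap hφ (𝓒.filter R)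
    fun C hC ↦ (Finset.mem_filter.1 hC).2
  set 𝓡 := 𝓒.filter fun C ↦ ¬ P C ∧ ¬ R C with h𝓡
  have key : ∀ C ∈ 𝓡, ∃ Ω, IsNodalDomain ψ Ω ∧ Ω ⊆ Ioo (0 : ℝ) 1 ×ˢ Ioo (0 : ℝ) 1 ∧
      ∀ p ∈ Ω, C = connectedComponentIn {z | φ z ≠ 0} (torusMk p) := by
    intro C hC
    obtain ⟨hC, hCP, hCR⟩ := Finset.mem_filter.1 hC
    obtain ⟨z, hz, rfl⟩ := h𝓒 C hC
    exact exists_isNodalDomain_subset_unitSquare hφ hz (fun t ht h ↦ hCP ⟨t, ht, h⟩)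
      fun t ht h ↦ hCR ⟨t, ht, h⟩
  choose! Ω hΩ hsub hC using key
  have hinj : Set.InjOn Ω 𝓡 := by
    intro C h C' h' hCC
    obtain ⟨p, hp⟩ := (hΩ C h).nonempty
    rw [hC C h p hp, hC C' h' p (hCC ▸ hp)]
  have h3 := card_le_two_mul_cos hε hθε hψ hper hn hlap hne hreg hsec (𝓡.image Ω)
    (Finset.forall_mem_image.2 hΩ) (Finset.forall_mem_image.2 hsub)
  rw [Finset.card_image_of_injOn hinj] at h3
  have h4 : 𝓒 ⊆ 𝓒.filter P ∪ 𝓒.filter R ∪ 𝓡 := by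
    intro C hC
    simp only [h𝓡, Finset.mem_union, Finset.mem_filter]
    by_cases h : P C <;> by_cases h' : R C <;> simp [hC, h, h']
  have h5 : 𝓒.card ≤ (𝓒.filter P).card + (𝓒.filter R).card + 𝓡.card :=
    (Finset.card_le_card h4).trans ((Finset.card_union_le _ _).trans
      (Nat.add_le_add_right (Finset.card_union_le _ _) _))
  have h6 : 𝓒.card ≤ 4 * Nat.sqrt n + 2 + 𝓡.card := by omega
  have h7 : (𝓒.card : ℝ) ≤ 4 * Nat.sqrt n + 2 + 𝓡.card := by exact_mod_cast h6
  have h8 : (Nat.sqrt n : ℝ) ≤ √n := Real.nat_sqrt_le_real_sqrt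
  have h9 : (1 : ℝ) ≤ √n := Real.one_le_sqrt.2 (by exact_mod_cast hn)
  linarith

end Torus

/-- nodal domain bound on the flat torus for eigenfunctions with
eigenvalue `4π²n` without singular points, whose lattice points on the circle of
radius `√n` all avoid some open sector of angle `2θ`. -/
theorem nodal_domain_bound_torus (θ ε : ℝ) (hε : 0 < ε) (hθε : ε < θ) :
    ∃ C : ℝ, 0 < C ∧
      ∀ (n : ℕ), 0 < n →
      ∀ ψ : ℝ × ℝ → ℝ, ContDiff ℝ (⊤ : ℕ∞) ψ →
        (∀ (p : ℝ × ℝ) (v : ℤ × ℤ), ψ (p.1 + (v.1 : ℝ), p.2 + (v.2 : ℝ)) = ψ p) →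
        (∃ p : ℝ × ℝ, ψ p ≠ 0) →
        (∀ p : ℝ × ℝ, laplacian2 ψ p = -(4 * π ^ 2 * n) * ψ p) →
        (∀ p : ℝ × ℝ, ψ p = 0 → fderiv ℝ ψ p ≠ 0) →
        (∃ α : ℝ, ∀ a b : ℤ, a ^ 2 + b ^ 2 = (n : ℤ) →
          ((a : ℝ), (b : ℝ)) ∉ openSector α (2 * θ)) →
        ∀ φ : Torus2 → ℝ,
          (∀ x y : ℝ, φ ((x : AddCircle (1 : ℝ)), (y : AddCircle (1 : ℝ))) = ψ (x, y)) →
          (({C' : Set Torus2 | ∃ x ∈ {z : Torus2 | φ z ≠ 0},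
              connectedComponentIn {z : Torus2 | φ z ≠ 0} x = C'}).Finite) ∧
          (({C' : Set Torus2 | ∃ x ∈ {z : Torus2 | φ z ≠ 0},
              connectedComponentIn {z : Torus2 | φ z ≠ 0} x = C'}).ncard : ℝ)
            ≤ 2 * n * Real.cos (θ - ε) + C * Real.sqrt n := by
  refine ⟨6, by norm_num, ?_⟩
  rintro n hn ψ hψ hper hne hlap hreg ⟨α, hsec⟩ φ hφ
  set 𝓢 := {C' : Set Torus2 | ∃ x ∈ {z : Torus2 | φ z ≠ 0},
    connectedComponentIn {z : Torus2 | φ z ≠ 0} x = C'}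
  have key : ∀ 𝓒 : Finset (Set Torus2), (𝓒 : Set (Set Torus2)) ⊆ 𝓢 →
      (𝓒.card : ℝ) ≤ 2 * n * Real.cos (θ - ε) + 6 * Real.sqrt n := fun 𝓒 h𝓒 ↦
    card_components_torus_le hε hθε (hψ.of_le (WithTop.coe_le_coe.2 le_top)) hper hn hlap hne hreg
      hsec (fun p ↦ hφ p.1 p.2) 𝓒 fun C hC ↦ h𝓒 hC
  have hfin : 𝓢.Finite := by
    by_contra h
    obtain ⟨m, hm⟩ := exists_nat_gt (2 * n * Real.cos (θ - ε) + 6 * Real.sqrt n)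
    obtain ⟨𝓒, h𝓒, hcard⟩ := Set.Infinite.exists_subset_card_eq h m
    exact absurd (hcard ▸ key 𝓒 h𝓒) (not_le.2 hm)
  refine ⟨hfin, ?_⟩
  rw [Set.ncard_eq_toFinset_card 𝓢 hfin]
  exact key _ (by simp)
end

section
/- Let n be a positive integer and ψ : ℝ² → ℝ a smooth ℤ²-periodic function with Δψ = −4π²n·ψ on ℝ². Let (p,q) ∈ ℤ² with q ≠ 0, and let K ≥ 0 be an integer such that |ap + bq| ≤ K for every (a,b) ∈ ℤ² with a² + b² = n. Then for every τ ∈ ℝ, the function g(t) = ψ(p(t − τ), qt) on ℝ is either identically zero or has at most 2K zeros in the half-open interval [0,1). -/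
open Real

/-- The character `x ↦ e^{2πikx}` of `ℝ/ℤ`, as a function on `ℝ`. -/
noncomputable def unitChar (k : ℤ) (x : ℝ) : ℂ :=
  Complex.exp (2 * π * Complex.I * k * x)

/-- The `k`-th Fourier coefficient of a `1`-periodic function on `ℝ`. -/
noncomputable def unitCoeff (f : ℝ → ℂ) (k : ℤ) : ℂ :=
  ∫ x in (0 : ℝ)..1, unitChar (-k) x * f x

@[fun_prop]
lemma continuous_unitChar (k : ℤ) : Continuous (unitChar k) := by
  unfold unitChar
  fun_prop

lemma hasDerivAt_unitChar (k : ℤ) (x : ℝ) :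
    HasDerivAt (unitChar k) (2 * π * Complex.I * k * unitChar k x) x := by
  have h : HasDerivAt (fun x : ℝ => 2 * π * Complex.I * k * (x : ℂ))
      (2 * π * Complex.I * k * 1) x := (Complex.ofRealCLM.hasDerivAt (x := x)).const_mul _
  convert! h.cexp using 1
  simp only [unitChar]
  ring

lemma unitChar_int (k m : ℤ) : unitChar k m = 1 :=
  Complex.exp_eq_one_iff.2 ⟨k * m, by push_cast; ring⟩

/-- A continuous periodic function whose Fourier coefficients have finite support is the
trigonometric polynomial with these coefficients. -/
lemma eq_sum_unitCoeff {f : ℝ → ℂ} (hf : Continuous f) (hper : Function.Periodic f 1)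
    (B : Finset ℤ) (hB : ∀ k ∉ B, unitCoeff f k = 0) (x : ℝ) :
    f x = ∑ k ∈ B, unitCoeff f k * unitChar k x := by
  let F : C(UnitAddCircle, ℂ) := ⟨hper.lift, continuous_coinduced_dom.mpr hf⟩
  have hF (x : ℝ) : F x = f x := hper.lift_coe x
  have hchar (k : ℤ) (x : ℝ) : fourier k (x : UnitAddCircle) = unitChar k x := by
    rw [fourier_coe_apply, unitChar]
    simp
  have hcoeff (k : ℤ) : fourierCoeff F k = unitCoeff f k := by
    rw [fourierCoeff_eq_intervalIntegral F k 0]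
    simp [unitCoeff, hF, hchar]
  have hsum : Summable (fourierCoeff F) :=
    summable_of_ne_finset_zero (s := B) fun k hk => (hcoeff k).trans (hB k hk)
  have h := has_pointwise_sum_fourier_series_of_summable hsum x
  simp only [hcoeff, hF, hchar, smul_eq_mul] at h
  exact h.unique (hasSum_sum_of_ne_finset_zero fun k hk => by simp [hB k hk])

lemma unitCoeff_deriv {h h' : ℝ → ℝ} (hd : ∀ x, HasDerivAt h (h' x) x) (hc : Continuous h')
    (hper : Function.Periodic h 1) (k : ℤ) :
    unitCoeff (fun x => (h' x : ℂ)) k =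
      2 * π * Complex.I * k * unitCoeff (fun x => (h x : ℂ)) k := by
  have h01 : h 1 = h 0 := by simpa using hper 0
  have e0 : unitChar (-k) 0 = 1 := by simpa using unitChar_int (-k) 0
  have e1 : unitChar (-k) 1 = 1 := by simpa using unitChar_int (-k) 1
  unfold unitCoeff
  rw [intervalIntegral.integral_mul_deriv_eq_deriv_mul
    (fun x _ => hasDerivAt_unitChar (-k) x) (fun x _ => (hd x).ofReal_comp)
    (Continuous.intervalIntegrable (by fun_prop) _ _)
    (Continuous.intervalIntegrable (by fun_prop) _ _), e0, e1, h01,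
    ← intervalIntegral.integral_const_mul, sub_self, zero_sub, ← intervalIntegral.integral_neg]
  congr 1 with x
  push_cast
  ring

lemma Function.Periodic.of_hasDerivAt {h h' : ℝ → ℝ} {c : ℝ} (hper : Function.Periodic h c)
    (hd : ∀ x, HasDerivAt h (h' x) x) : Function.Periodic h' c := fun x =>
  ((hd (x + c)).comp_add_const x c).unique (by
    have : (fun x => h (x + c)) = h := funext hper
    rw [this]
    exact hd x)

lemma unitCoeff_deriv_deriv {h h' h'' : ℝ → ℝ} (hd : ∀ x, HasDerivAt h (h' x) x)
    (hd' : ∀ x, HasDerivAt h' (h'' x) x) (hc : Continuous h'')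
    (hper : Function.Periodic h 1) (k : ℤ) :
    unitCoeff (fun x => (h'' x : ℂ)) k =
      -(4 * π ^ 2 * k ^ 2) * unitCoeff (fun x => (h x : ℂ)) k := by
  have hc' : Continuous h' := continuous_iff_continuousAt.2 fun x => (hd' x).continuousAt
  rw [unitCoeff_deriv hd' hc (hper.of_hasDerivAt hd), unitCoeff_deriv hd hc' hper]
  linear_combination (4 * π ^ 2 * k ^ 2 * unitCoeff (fun x => (h x : ℂ)) k) * Complex.I_sq

/-- The directional derivative of `f : ℝ × ℝ → ℝ` in the direction `v`. -/
noncomputable def dirDeriv (v : ℝ × ℝ) (f : ℝ × ℝ → ℝ) (p : ℝ × ℝ) : ℝ :=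
  fderiv ℝ f p v

lemma ContDiff.dirDeriv {f : ℝ × ℝ → ℝ} (hf : ContDiff ℝ (⊤ : ℕ∞) f) (v : ℝ × ℝ) :
    ContDiff ℝ (⊤ : ℕ∞) (dirDeriv v f) :=
  (hf.fderiv_right (m := (⊤ : ℕ∞)) le_rfl).clm_apply contDiff_const

lemma hasDerivAt_fst {f : ℝ × ℝ → ℝ} (hf : ContDiff ℝ (⊤ : ℕ∞) f) (x y : ℝ) :
    HasDerivAt (fun x' => f (x', y)) (dirDeriv (1, 0) f (x, y)) x :=
  ((hf.differentiable (by simp)) (x, y)).hasFDerivAt.comp_hasDerivAt x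
    ((hasDerivAt_id x).prodMk (hasDerivAt_const x y))

lemma hasDerivAt_snd {f : ℝ × ℝ → ℝ} (hf : ContDiff ℝ (⊤ : ℕ∞) f) (x y : ℝ) :
    HasDerivAt (fun y' => f (x, y')) (dirDeriv (0, 1) f (x, y)) y :=
  ((hf.differentiable (by simp)) (x, y)).hasFDerivAt.comp_hasDerivAt y
    ((hasDerivAt_const y x).prodMk (hasDerivAt_id y))

lemma laplacian2_eq_dirDeriv {f : ℝ × ℝ → ℝ} (hf : ContDiff ℝ (⊤ : ℕ∞) f) (p : ℝ × ℝ) :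
    laplacian2 f p =
      dirDeriv (1, 0) (dirDeriv (1, 0) f) p + dirDeriv (0, 1) (dirDeriv (0, 1) f) p := by
  simp only [laplacian2, (hasDerivAt_fst hf _ _).deriv, (hasDerivAt_snd hf _ _).deriv,
    (hasDerivAt_fst (hf.dirDeriv _) _ _).deriv, (hasDerivAt_snd (hf.dirDeriv _) _ _).deriv]

lemma continuous_unitCoeff {f : ℝ → ℝ → ℂ} (hf : Continuous f.uncurry) (k : ℤ) :
    Continuous fun y => unitCoeff (f y) k :=
  intervalIntegral.continuous_parametric_intervalIntegral_of_continuous'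
    (by simp only [Function.uncurry_def] at hf ⊢; fun_prop) 0 1

lemma unitCoeff_const_mul (c : ℂ) (f : ℝ → ℂ) (k : ℤ) :
    unitCoeff (fun x => c * f x) k = c * unitCoeff f k := by
  unfold unitCoeff
  rw [← intervalIntegral.integral_const_mul]
  congr 1 with x
  ring

lemma unitCoeff_sub {f g : ℝ → ℂ} (hf : Continuous f) (hg : Continuous g) (k : ℤ) :
    unitCoeff (fun x => f x - g x) k = unitCoeff f k - unitCoeff g k := by
  unfold unitCoeff
  rw [← intervalIntegral.integral_sub (Continuous.intervalIntegrable (by fun_prop) _ _)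
    (Continuous.intervalIntegrable (by fun_prop) _ _)]
  congr 1 with x
  ring

lemma unitCoeff_swap {f : ℝ → ℝ → ℂ} (hf : Continuous f.uncurry) (a b : ℤ) :
    unitCoeff (fun y => unitCoeff (fun x => f x y) a) b =
      unitCoeff (fun x => unitCoeff (fun y => f x y) b) a := by
  simp only [unitCoeff, ← intervalIntegral.integral_const_mul]
  rw [MeasureTheory.intervalIntegral_intervalIntegral_swap]
  · congr 1 with x
    congr 1 with y
    ring
  · have hc : Continuous (Function.uncurry fun y x =>
        unitChar (-b) y * (unitChar (-a) x * f x y)) := by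
      simp only [Function.uncurry_def] at hf ⊢
      have := hf.comp continuous_swap
      simp only [Function.comp_def, Prod.fst_swap, Prod.snd_swap] at this
      fun_prop
    exact (hc.continuousOn.integrableOn_compact
      (isCompact_uIcc.prod isCompact_uIcc)).mono_set
        (Set.prod_mono Set.uIoc_subset_uIcc Set.uIoc_subset_uIcc)

/-- The Fourier coefficients of a toral eigenfunction vanish off the circle `a² + b² = n`. -/
lemma unitCoeff_unitCoeff_eq_zero {n : ℕ} {ψ : ℝ × ℝ → ℝ}
    (hsmooth : ContDiff ℝ (⊤ : ℕ∞) ψ)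
    (hper₁ : ∀ y, Function.Periodic (fun x => ψ (x, y)) 1)
    (hper₂ : ∀ x, Function.Periodic (fun y => ψ (x, y)) 1)
    (heig : ∀ x : ℝ × ℝ, laplacian2 ψ x = -(4 * π ^ 2 * n) * ψ x)
    {a b : ℤ} (hab : a ^ 2 + b ^ 2 ≠ (n : ℤ)) :
    unitCoeff (fun y => unitCoeff (fun x => (ψ (x, y) : ℂ)) a) b = 0 := by
  have hcψ := hsmooth.continuous
  have hcx := ((hsmooth.dirDeriv (1, 0)).dirDeriv (1, 0)).continuous
  have hcy := ((hsmooth.dirDeriv (0, 1)).dirDeriv (0, 1)).continuous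
  set ψxx := dirDeriv (1, 0) (dirDeriv (1, 0) ψ)
  set ψyy := dirDeriv (0, 1) (dirDeriv (0, 1) ψ)
  have hxx (y : ℝ) : unitCoeff (fun x => (ψxx (x, y) : ℂ)) a =
      -(4 * π ^ 2 * a ^ 2) * unitCoeff (fun x => (ψ (x, y) : ℂ)) a :=
    unitCoeff_deriv_deriv (fun x => hasDerivAt_fst hsmooth x y)
      (fun x => hasDerivAt_fst (hsmooth.dirDeriv _) x y)
      (hcx.comp (by fun_prop : Continuous fun x => (x, y))) (hper₁ y) a
  have hyy (x : ℝ) : unitCoeff (fun y => (ψyy (x, y) : ℂ)) b =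
      -(4 * π ^ 2 * b ^ 2) * unitCoeff (fun y => (ψ (x, y) : ℂ)) b :=
    unitCoeff_deriv_deriv (fun y => hasDerivAt_snd hsmooth x y)
      (fun y => hasDerivAt_snd (hsmooth.dirDeriv _) x y)
      (hcy.comp (by fun_prop : Continuous fun y => (x, y))) (hper₂ x) b
  have heq (x y : ℝ) : (ψyy (x, y) : ℂ) = -(4 * π ^ 2 * n) * ψ (x, y) - ψxx (x, y) := by
    have h := heig (x, y)
    rw [laplacian2_eq_dirDeriv hsmooth] at h
    rw [eq_sub_iff_add_eq']
    exact_mod_cast h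
  clear_value ψxx ψyy
  have hyy' (y : ℝ) : unitCoeff (fun x => (ψyy (x, y) : ℂ)) a =
      (4 * π ^ 2 * (a ^ 2 - n)) * unitCoeff (fun x => (ψ (x, y) : ℂ)) a := by
    simp only [heq]
    rw [unitCoeff_sub (by fun_prop) (by fun_prop), unitCoeff_const_mul, hxx]
    ring
  have key := unitCoeff_swap (f := fun x y => (ψyy (x, y) : ℂ))
    (by simp only [Function.uncurry_def]; fun_prop) a b
  simp only [hyy, hyy', unitCoeff_const_mul] at key
  rw [← unitCoeff_swap (f := fun x y => (ψ (x, y) : ℂ))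
    (by simp only [Function.uncurry_def]; fun_prop) a b] at key
  set c := unitCoeff (fun y => unitCoeff (fun x => (ψ (x, y) : ℂ)) a) b
  have hne : ((a : ℂ) ^ 2 + b ^ 2 - n) ≠ 0 := by
    rw [sub_ne_zero]
    exact_mod_cast hab
  have hπ : (4 * π ^ 2 : ℂ) ≠ 0 := by simp [Real.pi_ne_zero]
  have : (4 * π ^ 2 : ℂ) * ((a : ℂ) ^ 2 + b ^ 2 - n) * c = 0 := by linear_combination key
  exact (mul_eq_zero.1 this).resolve_left (mul_ne_zero hπ hne)

/-- A toral eigenfunction is a trigonometric polynomial with frequencies on a circle. -/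
lemma exists_eq_sum_unitChar {n : ℕ} {ψ : ℝ × ℝ → ℝ}
    (hsmooth : ContDiff ℝ (⊤ : ℕ∞) ψ)
    (hper : ∀ (x : ℝ × ℝ) (v : ℤ × ℤ), ψ (x.1 + (v.1 : ℝ), x.2 + (v.2 : ℝ)) = ψ x)
    (heig : ∀ x : ℝ × ℝ, laplacian2 ψ x = -(4 * π ^ 2 * n) * ψ x) :
    ∃ (S : Finset (ℤ × ℤ)) (c : ℤ × ℤ → ℂ), (∀ v ∈ S, v.1 ^ 2 + v.2 ^ 2 = (n : ℤ)) ∧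
      ∀ x y : ℝ, (ψ (x, y) : ℂ) = ∑ v ∈ S, c v * (unitChar v.1 x * unitChar v.2 y) := by
  have hper₁ (y : ℝ) : Function.Periodic (fun x => ψ (x, y)) 1 := fun x => by
    simpa using hper (x, y) (1, 0)
  have hper₂ (x : ℝ) : Function.Periodic (fun y => ψ (x, y)) 1 := fun y => by
    simpa using hper (x, y) (0, 1)
  have hcψ := hsmooth.continuous
  let F (a : ℤ) (y : ℝ) : ℂ := unitCoeff (fun x => (ψ (x, y) : ℂ)) a
  let c (v : ℤ × ℤ) : ℂ := unitCoeff (F v.1) v.2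
  have hc {a b : ℤ} (hab : a ^ 2 + b ^ 2 ≠ (n : ℤ)) : c (a, b) = 0 :=
    unitCoeff_unitCoeff_eq_zero hsmooth hper₁ hper₂ heig hab
  have hFc (a : ℤ) : Continuous (F a) :=
    continuous_unitCoeff (f := fun y x => (ψ (x, y) : ℂ))
      (by simp only [Function.uncurry_def]; fun_prop) a
  have hFper (a : ℤ) : Function.Periodic (F a) 1 := fun y => by
    have h (x : ℝ) : ψ (x, y + 1) = ψ (x, y) := hper₂ x y
    simp only [F, h]
  let B : Finset ℤ := Finset.Icc (-n) n
  have hB {a : ℤ} (ha : a ∉ B) : (n : ℤ) < a ^ 2 := by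
    simp only [B, Finset.mem_Icc, ← abs_le, not_le] at ha
    nlinarith [sq_abs a]
  have hF (a : ℤ) (y : ℝ) : F a y = ∑ b ∈ B, c (a, b) * unitChar b y :=
    eq_sum_unitCoeff (hFc a) (hFper a) B
      (fun b hb => hc (by nlinarith [hB hb, sq_nonneg a])) y
  have hψ (x y : ℝ) : (ψ (x, y) : ℂ) = ∑ a ∈ B, F a y * unitChar a x := by
    refine eq_sum_unitCoeff (f := fun x => (ψ (x, y) : ℂ)) (by fun_prop)
      (fun x => by simpa using hper₁ y x) B (fun a ha => ?_) x
    change F a y = 0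
    rw [hF]
    exact Finset.sum_eq_zero fun b _ => by
      rw [hc (by nlinarith [hB ha, sq_nonneg b]), zero_mul]
  refine ⟨(B ×ˢ B).filter fun v => v.1 ^ 2 + v.2 ^ 2 = (n : ℤ), c,
    fun v hv => (Finset.mem_filter.1 hv).2, fun x y => ?_⟩
  rw [Finset.sum_filter_of_ne (fun v _ hv => by
    by_contra h
    exact hv (by rw [hc h, zero_mul])), Finset.sum_product, hψ]
  refine Finset.sum_congr rfl fun a _ => ?_
  rw [hF, Finset.sum_mul]
  exact Finset.sum_congr rfl fun b _ => by ring

lemma injOn_unitChar_one : Set.InjOn (unitChar 1) (Set.Ico 0 1) := by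
  intro s hs t ht h
  obtain ⟨m, hm⟩ := Complex.exp_eq_exp_iff_exists_int.1 h
  have h' : (s : ℂ) = t + m := by
    have := Complex.two_pi_I_ne_zero
    refine mul_left_cancel₀ this ?_
    push_cast at hm
    linear_combination hm
  have h'' : s = t + m := by exact_mod_cast h'
  have h1 : m < 1 := by
    have : (m : ℝ) < 1 := by linarith [hs.2, ht.1]
    exact_mod_cast this
  have h2 : -1 < m := by
    have : (-1 : ℝ) < m := by linarith [hs.1, ht.2]
    exact_mod_cast this
  obtain rfl : m = 0 := by omega
  simpa using h''

lemma unitChar_add (k l : ℤ) (x : ℝ) : unitChar (k + l) x = unitChar k x * unitChar l x := by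
  simp only [unitChar, ← Complex.exp_add]
  congr 1
  push_cast
  ring

lemma unitChar_one_pow (k : ℕ) (x : ℝ) : unitChar 1 x ^ k = unitChar k x := by
  rw [unitChar, ← Complex.exp_nat_mul, unitChar]
  congr 1
  push_cast
  ring

/-- A trigonometric polynomial of degree at most `K` which is not identically zero has at most
`2K` zeros in a period. -/
lemma encard_zeros_le_of_eq_sum_unitChar {ι : Type*} (S : Finset ι) (c : ι → ℂ) (m : ι → ℤ)
    (K : ℕ) (hm : ∀ i ∈ S, |m i| ≤ (K : ℤ)) {g : ℝ → ℂ}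
    (hg : ∀ t, g t = ∑ i ∈ S, c i * unitChar (m i) t) :
    (∀ t, g t = 0) ∨ {t ∈ Set.Ico (0 : ℝ) 1 | g t = 0}.encard ≤ (2 * K : ℕ) := by
  open Polynomial in
  let P : ℂ[X] := ∑ i ∈ S, C (c i) * X ^ (m i + K).toNat
  have hdeg : P.natDegree ≤ 2 * K := by
    refine natDegree_sum_le_of_forall_le _ _ fun i hi => (natDegree_C_mul_X_pow_le _ _).trans ?_
    have := abs_le.1 (hm i hi)
    omega
  have hP (t : ℝ) : P.eval (unitChar 1 t) = unitChar K t * g t := by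
    rw [hg, Finset.mul_sum, eval_finsetSum]
    refine Finset.sum_congr rfl fun i hi => ?_
    have := abs_le.1 (hm i hi)
    rw [eval_C_mul, eval_pow, eval_X, unitChar_one_pow, Int.toNat_of_nonneg (by omega),
      unitChar_add]
    ring
  by_cases h0 : P = 0
  · refine Or.inl fun t => ?_
    have h := hP t
    rw [h0, eval_zero, zero_eq_mul] at h
    exact h.resolve_left (Complex.exp_ne_zero _)
  · right
    have hinj : Set.InjOn (unitChar 1) {t ∈ Set.Ico (0 : ℝ) 1 | g t = 0} :=
      injOn_unitChar_one.mono fun t ht => ht.1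
    rw [← hinj.encard_image]
    calc (unitChar 1 '' {t ∈ Set.Ico (0 : ℝ) 1 | g t = 0}).encard
        ≤ (P.roots.toFinset : Set ℂ).encard := by
          refine Set.encard_le_encard ?_
          rintro _ ⟨t, ht, rfl⟩
          simp [h0, hP, ht.2]
      _ = (P.roots.toFinset.card : ℕ∞) := Set.encard_coe_eq_coe_finsetCard _
      _ ≤ (2 * K : ℕ) := by
          exact_mod_cast (Multiset.toFinset_card_le _).trans ((card_roots' P).trans hdeg)

/-- the restriction of a toral eigenfunction with eigenvalue `4π²n` to
the line `t ↦ (p(t−τ), qt)` is either identically zero or has at most `2K` zeros in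
`[0,1)`, where `K` bounds `|ap + bq|` over lattice points `(a,b)` with `a² + b² = n`. -/
theorem toral_eigenfunction_line_zeros
    (n : ℕ) (hn : 0 < n) (ψ : ℝ × ℝ → ℝ)
    (hsmooth : ContDiff ℝ (⊤ : ℕ∞) ψ)
    (hper : ∀ (x : ℝ × ℝ) (v : ℤ × ℤ), ψ (x.1 + (v.1 : ℝ), x.2 + (v.2 : ℝ)) = ψ x)
    (heig : ∀ x : ℝ × ℝ, laplacian2 ψ x = -(4 * π ^ 2 * n) * ψ x)
    (p q : ℤ) (hq : q ≠ 0) (K : ℕ)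
    (hK : ∀ a b : ℤ, a ^ 2 + b ^ 2 = (n : ℤ) → |a * p + b * q| ≤ (K : ℤ)) :
    ∀ τ : ℝ,
      (∀ t : ℝ, ψ ((p : ℝ) * (t - τ), (q : ℝ) * t) = 0) ∨
      {t ∈ Set.Ico (0 : ℝ) 1 | ψ ((p : ℝ) * (t - τ), (q : ℝ) * t) = 0}.encard
        ≤ (2 * K : ℕ) := by
  intro τ
  obtain ⟨S, c, hS, hψ⟩ := exists_eq_sum_unitChar hsmooth hper heig
  have h := encard_zeros_le_of_eq_sum_unitChar S
    (fun v => c v * Complex.exp (-(2 * π * Complex.I * v.1 * p * τ)))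
    (fun v => v.1 * p + v.2 * q) K (fun v hv => hK v.1 v.2 (hS v hv))
    (g := fun t => (ψ ((p : ℝ) * (t - τ), (q : ℝ) * t) : ℂ)) (fun t => by
      rw [hψ]
      refine Finset.sum_congr rfl fun v _ => ?_
      simp only [unitChar, mul_assoc (c v), ← Complex.exp_add]
      congr 2
      push_cast
      ring)
  simpa only [Complex.ofReal_eq_zero] using h
end
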